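/- Let F:(ℝ^m,0)→(ℝ^p,0) and G:(ℝ^p,0)→(ℝ^k,0) (m≥p≥k≥2) be analytic map germs with isolated critical value 0, with F satisfying the Milnor condition (b), and let H=G∘F. If F(M(H))⊆M(G) as set germs at 0 and G satisfies the Milnor condition (b), then the transversality condition closure(F(M(H)∖Sing H)) ∩ Sing G ⊆ {0} holds (and hence H satisfies the Milnor condition (b)). -/

import Mathlib

noncomputable section

/-- The singular set of a map: points where the derivative is not surjective. -/
def SingSet {X Y : Type*} [NormedAddCommGroup X] [NormedSpace ℝ X]
    [NormedAddCommGroup Y] [NormedSpace ℝ Y] (Φ : X → Y) : Set X :=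
  {x | ¬ Function.Surjective (fderiv ℝ Φ x)}

/-- The Milnor set of `Φ` with respect to `ρ = ‖·‖²`: the singular set of the pair
`(Φ, ρ)`. -/
def MilnorSet {X Y : Type*} [NormedAddCommGroup X] [NormedSpace ℝ X]
    [NormedAddCommGroup Y] [NormedSpace ℝ Y] (Φ : X → Y) : Set X :=
  SingSet (fun x => (Φ x, ‖x‖ ^ 2))

/-- The Milnor condition (b) at the origin (as a germ at `0`):
`closure (M(Φ) ∖ Φ⁻¹(0)) ∩ Φ⁻¹(0) ⊆ {0}` near the origin. -/
def MilnorCondB {X Y : Type*} [NormedAddCommGroup X] [NormedSpace ℝ X]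
    [NormedAddCommGroup Y] [NormedSpace ℝ Y] (Φ : X → Y) : Prop :=
  ∃ ε > (0 : ℝ),
    closure ((MilnorSet Φ \ Φ ⁻¹' {0}) ∩ Metric.ball 0 ε) ∩ Φ ⁻¹' {0} ⊆ {0}

open PowerSeries in
/-- The algebra of real power series with absolutely summable coefficients. -/
def wienerAlgebra : Subalgebra ℝ (PowerSeries ℝ) where
  carrier := {f | Summable fun n => ‖coeff n f‖}
  mul_mem' {f g} hf hg := by
    change Summable fun n => ‖coeff n (f * g)‖
    simp only [coeff_mul]
    exact summable_norm_sum_mul_antidiagonal_of_summable_norm (f := fun n => coeff n f)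
      (g := fun n => coeff n g) hf hg
  add_mem' {f g} hf hg := by
    change Summable fun n => ‖coeff n (f + g)‖
    simp only [map_add]
    exact Summable.of_nonneg_of_le (fun _ => norm_nonneg _) (fun _ => norm_add_le _ _)
      (hf.add hg)
  algebraMap_mem' r := by
    refine summable_of_ne_finset_zero (s := {0}) fun n hn => ?_
    simp only [Finset.mem_singleton] at hn
    simp [coeff_C, hn]

/-- The Wiener algebra as a type. -/
abbrev Wiener : Type := wienerAlgebra

namespace Wiener

open PowerSeries

theorem summable (f : Wiener) : Summable fun n => ‖coeff n (f : ℝ⟦X⟧)‖ := f.2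

instance : Norm Wiener := ⟨fun f => ∑' n, ‖coeff n (f : ℝ⟦X⟧)‖⟩

theorem norm_def (f : Wiener) : ‖f‖ = ∑' n, ‖coeff n (f : ℝ⟦X⟧)‖ := rfl

theorem norm_coeff_le (f : Wiener) (n : ℕ) : ‖coeff n (f : ℝ⟦X⟧)‖ ≤ ‖f‖ :=
  (summable f).le_tsum n fun _ _ => norm_nonneg _

theorem norm_mul_le' (f g : Wiener) : ‖f * g‖ ≤ ‖f‖ * ‖g‖ := by
  simp only [norm_def]
  rw [tsum_mul_tsum_eq_tsum_sum_antidiagonal_of_summable_norm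
    (f := fun n => ‖coeff n (f : ℝ⟦X⟧)‖) (g := fun n => ‖coeff n (g : ℝ⟦X⟧)‖)
    (summable f).norm (summable g).norm]
  refine (summable (f * g)).tsum_le_tsum (fun n => ?_) ?_
  · simp only [MulMemClass.coe_mul, coeff_mul]
    exact (norm_sum_le _ _).trans (Finset.sum_le_sum fun _ _ => norm_mul_le _ _)
  · exact (summable_norm_sum_mul_antidiagonal_of_summable_norm
      (f := fun n => ‖coeff n (f : ℝ⟦X⟧)‖) (g := fun n => ‖coeff n (g : ℝ⟦X⟧)‖)
      (summable f).norm (summable g).norm).of_norm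

instance : NormedAddCommGroup Wiener :=
  AddGroupNorm.toNormedAddCommGroup
    { toFun := norm
      map_zero' := by simp [norm_def]
      add_le' := fun f g => by
        simp only [norm_def]
        rw [← (summable f).tsum_add (summable g)]
        refine (summable (f + g)).tsum_le_tsum (fun n => ?_) ((summable f).add (summable g))
        simpa using abs_add_le _ _
      neg' := fun f => by simp [norm_def]
      eq_zero_of_map_eq_zero' := fun f hf => by
        ext n
        simpa using le_antisymm ((norm_coeff_le f n).trans hf.le) (norm_nonneg _) }

instance : NormedCommRing Wiener where
  dist_eq := fun _ _ => dist_eq_norm_neg_add _ _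
  norm_mul_le := norm_mul_le'
  mul_comm := mul_comm

theorem norm_smul' (r : ℝ) (f : Wiener) : ‖r • f‖ = ‖r‖ * ‖f‖ := by
  simp only [norm_def, ← tsum_mul_left]
  simp

instance : NormedAlgebra ℝ Wiener where
  norm_smul_le r f := (norm_smul' r f).le

instance : NormOneClass Wiener where
  norm_one := by
    rw [norm_def, tsum_eq_single 0]
    · simp
    · intro n hn
      simp [coeff_one, hn]

/-- The isometry of the Wiener algebra with `ℓ¹`. -/
def toLp : Wiener ≃ lp (fun _ : ℕ => ℝ) 1 where
  toFun f := ⟨fun n => coeff n (f : ℝ⟦X⟧), by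
    apply memℓp_gen
    simpa using summable f⟩
  invFun f := ⟨PowerSeries.mk f, by
    have := lp.memℓp f
    rw [memℓp_gen_iff (by simp)] at this
    simpa [wienerAlgebra] using this⟩
  left_inv f := by ext n; simp
  right_inv f := by ext n; simp

theorem isometry_toLp : Isometry toLp := by
  refine Isometry.of_dist_eq fun f g => ?_
  rw [dist_eq_norm, dist_eq_norm, lp.norm_eq_tsum_rpow (by simp), norm_def]
  simp only [toLp, AddSubgroupClass.coe_sub, map_sub, Equiv.coe_fn_mk, ENNReal.toReal_one,
    Real.rpow_one, div_one]
  rfl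

instance : CompleteSpace Wiener :=
  (IsometryEquiv.mk toLp isometry_toLp).completeSpace

/-- The variable. -/
def var : Wiener := ⟨X, by
  refine summable_of_ne_finset_zero (s := {1}) fun n hn => ?_
  simp only [Finset.mem_singleton] at hn
  simp [coeff_X, hn]⟩

/-- Evaluation at a point of `[-1, 1]`. -/
def evalAt (t : ℝ) (ht : |t| ≤ 1) : Wiener →ₐ[ℝ] ℝ :=
  have hs (f : Wiener) : Summable fun n => ‖coeff n (f : ℝ⟦X⟧) * t ^ n‖ :=
    (summable f).of_nonneg_of_le (fun _ => norm_nonneg _) fun n => by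
      rw [norm_mul, norm_pow]
      exact mul_le_of_le_one_right (norm_nonneg _) (pow_le_one₀ (norm_nonneg _) ht)
  AlgHom.ofLinearMap
    { toFun := fun f => ∑' n, coeff n (f : ℝ⟦X⟧) * t ^ n
      map_add' := fun f g => by
        rw [← (hs f).of_norm.tsum_add (hs g).of_norm]
        simp [add_mul]
      map_smul' := fun r f => by
        simp [← tsum_mul_left, mul_assoc] }
    (by
      simp only [LinearMap.coe_mk, AddHom.coe_mk]
      rw [tsum_eq_single 0]
      · simp
      · intro n hn
        simp [coeff_one, hn])
    (fun f g => by
      simp only [LinearMap.coe_mk, AddHom.coe_mk]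
      rw [tsum_mul_tsum_eq_tsum_sum_antidiagonal_of_summable_norm (hs f) (hs g)]
      congr 1
      ext n
      simp only [MulMemClass.coe_mul, coeff_mul, Finset.sum_mul]
      refine Finset.sum_congr rfl fun p hp => ?_
      rw [← Finset.HasAntidiagonal.mem_antidiagonal.1 hp, pow_add]
      ring)

theorem evalAt_apply {t : ℝ} (ht : |t| ≤ 1) (f : Wiener) :
    evalAt t ht f = ∑' n, coeff n (f : ℝ⟦X⟧) * t ^ n := rfl

theorem abs_evalAt_le {t : ℝ} (ht : |t| ≤ 1) (f : Wiener) : |evalAt t ht f| ≤ ‖f‖ := by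
  rw [evalAt_apply]
  rw [← Real.norm_eq_abs]
  refine tsum_of_norm_bounded (summable f).hasSum fun n => ?_
  rw [norm_mul, norm_pow]
  exact mul_le_of_le_one_right (norm_nonneg _) (pow_le_one₀ (norm_nonneg _) ht)

@[simp]
theorem evalAt_var {t : ℝ} (ht : |t| ≤ 1) : evalAt t ht var = t := by
  rw [evalAt_apply, tsum_eq_single 1]
  · simp [var]
  · intro n hn
    simp [var, coeff_X, hn]

/-- The constant coefficient. -/
def const : Wiener →L[ℝ] ℝ :=
  LinearMap.mkContinuous
    { toFun := fun f => coeff 0 (f : ℝ⟦X⟧)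
      map_add' := by simp
      map_smul' := by simp } 1 fun f => by simpa using norm_coeff_le f 0

theorem const_mul (f g : Wiener) : const (f * g) = const f * const g := by
  simp [const]

/-- Removal of the constant coefficient followed by division by the variable. -/
def shift : Wiener →L[ℝ] Wiener :=
  LinearMap.mkContinuous
    { toFun := fun f => ⟨PowerSeries.mk fun n => coeff (n + 1) (f : ℝ⟦X⟧), by
        simpa [wienerAlgebra] using (summable_nat_add_iff 1).2 (summable f)⟩
      map_add' := fun f g => by ext n; simp
      map_smul' := fun r f => by ext n; simp } 1 fun f => by
    rw [one_mul, norm_def, norm_def, (summable f).tsum_eq_zero_add]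
    simp

@[simp]
theorem coeff_shift (f : Wiener) (n : ℕ) :
    coeff n (shift f : ℝ⟦X⟧) = coeff (n + 1) (f : ℝ⟦X⟧) := by
  simp [shift]

theorem eq_const_add_var_mul_shift (f : Wiener) : f = const f • 1 + var * shift f := by
  ext n
  rcases n with _ | n
  · simp [const, var]
  · simp [const, var, coeff_succ_X_mul, coeff_one]

@[simp]
theorem shift_var_mul (f : Wiener) : shift (var * f) = f := by
  ext n
  simp [var, coeff_succ_X_mul]

@[simp]
theorem iterate_shift_var_pow_mul (d : ℕ) (f : Wiener) : shift^[d] (var ^ d * f) = f := by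
  induction d with
  | zero => simp
  | succ d ih => rw [Function.iterate_succ_apply, pow_succ', mul_assoc, shift_var_mul, ih]

theorem eq_sum_add_var_pow_mul (d : ℕ) (f : Wiener) :
    f = ∑ j ∈ Finset.range d, const (shift^[j] f) • var ^ j + var ^ d * shift^[d] f := by
  induction d with
  | zero => simp
  | succ d ih =>
    rw [Finset.sum_range_succ, Function.iterate_succ_apply']
    conv_lhs => rw [ih, eq_const_add_var_mul_shift (shift^[d] f)]
    rw [mul_add, pow_succ, mul_assoc, mul_smul_comm, mul_one, add_assoc]

theorem exists_eq_var_pow_mul {f : Wiener} (hf : f ≠ 0) :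
    ∃ d u, f = var ^ d * u ∧ const u ≠ 0 := by
  have h : ∃ n, coeff n (f : ℝ⟦X⟧) ≠ 0 := by
    by_contra! h
    exact hf (by ext n; simpa using h n)
  classical
  have hc (j : ℕ) : const (shift^[j] f) = coeff j (f : ℝ⟦X⟧) := by
    have (j n : ℕ) : coeff n ((shift^[j] f : Wiener) : ℝ⟦X⟧) = coeff (n + j) (f : ℝ⟦X⟧) := by
      induction j generalizing n with
      | zero => simp
      | succ j ih => rw [Function.iterate_succ_apply', coeff_shift, ih]; congr 2; ring
    simpa [const] using this j 0
  refine ⟨Nat.find h, shift^[Nat.find h] f, ?_, ?_⟩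
  · conv_lhs => rw [eq_sum_add_var_pow_mul (Nat.find h) f]
    rw [Finset.sum_eq_zero, zero_add]
    intro j hj
    have := Nat.find_min h (Finset.mem_range.1 hj)
    rw [hc, not_not.1 this, zero_smul]
  · rw [hc]
    exact Nat.find_spec h

/-- The substitution `X ↦ c X` for `|c| ≤ 1`. -/
def dilate (c : ℝ) (hc : |c| ≤ 1) : Wiener →L[ℝ] Wiener :=
  have hb (f : Wiener) (n : ℕ) : ‖coeff n (rescale c (f : ℝ⟦X⟧))‖ ≤ ‖coeff n (f : ℝ⟦X⟧)‖ := by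
    rw [coeff_rescale, norm_mul, norm_pow]
    exact mul_le_of_le_one_left (norm_nonneg _) (pow_le_one₀ (norm_nonneg _) hc)
  have hs (f : Wiener) : Summable fun n => ‖coeff n (rescale c (f : ℝ⟦X⟧))‖ :=
    (summable f).of_nonneg_of_le (fun _ => norm_nonneg _) (hb f)
  LinearMap.mkContinuous
    { toFun := fun f => ⟨rescale c f, hs f⟩
      map_add' := fun f g => by ext n; simp
      map_smul' := fun r f => by ext n; simp; ring } 1 fun f => by
    rw [one_mul]
    exact (hs f).tsum_le_tsum (hb f) (summable f)

theorem coeff_dilate {c : ℝ} (hc : |c| ≤ 1) (f : Wiener) (n : ℕ) :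
    coeff n (dilate c hc f : ℝ⟦X⟧) = c ^ n * coeff n (f : ℝ⟦X⟧) := by
  simp [dilate]

theorem norm_dilate_le {c : ℝ} (hc : |c| ≤ 1) (f : Wiener) : ‖dilate c hc f‖ ≤ ‖f‖ := by
  refine (summable (dilate c hc f)).tsum_le_tsum (fun n => ?_) (summable f)
  rw [coeff_dilate, norm_mul, norm_pow]
  exact mul_le_of_le_one_left (norm_nonneg _) (pow_le_one₀ (norm_nonneg _) hc)

theorem dilate_mul {c : ℝ} (hc : |c| ≤ 1) (f g : Wiener) :
    dilate c hc (f * g) = dilate c hc f * dilate c hc g :=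
  Subtype.ext (map_mul (rescale c) (f : ℝ⟦X⟧) g)

theorem dilate_var {c : ℝ} (hc : |c| ≤ 1) : dilate c hc var = c • var := by
  ext n
  rw [coeff_dilate]
  by_cases hn : n = 1 <;> simp [var, coeff_X, hn]

theorem dilate_one {c : ℝ} (hc : |c| ≤ 1) : dilate c hc 1 = 1 :=
  Subtype.ext (map_one (rescale c))

theorem dilate_var_pow {c : ℝ} (hc : |c| ≤ 1) (d : ℕ) :
    dilate c hc (var ^ d) = c ^ d • var ^ d := by
  induction d with
  | zero => simp [dilate_one]
  | succ d ih => rw [pow_succ, dilate_mul, ih, dilate_var, smul_mul_smul_comm, pow_succ]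

theorem evalAt_dilate {c t : ℝ} (hc : |c| ≤ 1) (ht : |t| ≤ 1) (hct : |c * t| ≤ 1) (f : Wiener) :
    evalAt t ht (dilate c hc f) = evalAt (c * t) hct f := by
  simp only [evalAt_apply, coeff_dilate]
  congr 1
  ext n
  ring

theorem norm_var_le : ‖var‖ ≤ 1 := by
  rw [norm_def, tsum_eq_single 1]
  · simp [var]
  · intro n hn
    simp [var, coeff_X, hn]

theorem dilate_eq {c : ℝ} (hc : |c| ≤ 1) (u : Wiener) :
    dilate c hc u = const u • 1 + c • (var * dilate c hc (shift u)) := by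
  conv_lhs => rw [eq_const_add_var_mul_shift u]
  rw [map_add, map_smul, dilate_one, dilate_mul, dilate_var, smul_mul_assoc]

theorem exists_isUnit_dilate {u : Wiener} (hu : const u ≠ 0) :
    ∃ δ > 0, ∀ c (hc : |c| ≤ 1), |c| < δ → IsUnit (dilate c hc u) := by
  refine ⟨|const u| / (‖shift u‖ + 1), by positivity, fun c hc hcδ => ?_⟩
  have h : dilate c hc u = algebraMap ℝ Wiener (const u) *
      (1 - (-(c / const u)) • (var * dilate c hc (shift u))) := by
    rw [dilate_eq, ← Algebra.smul_def, smul_sub, smul_smul, mul_neg, mul_div_cancel₀ _ hu,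
      neg_smul, sub_neg_eq_add]
  rw [h]
  refine ((isUnit_iff_ne_zero.2 hu).map (algebraMap ℝ Wiener)).mul
    (isUnit_one_sub_of_norm_lt_one ?_)
  rw [lt_div_iff₀ (by positivity)] at hcδ
  have h1 : ‖var * dilate c hc (shift u)‖ ≤ ‖shift u‖ :=
    (norm_mul_le _ _).trans <|
      (mul_le_of_le_one_left (norm_nonneg _) norm_var_le).trans (norm_dilate_le hc _)
  rw [norm_smul, norm_neg, norm_div, div_mul_eq_mul_div, div_lt_one (norm_pos_iff.2 hu)]
  calc ‖c‖ * ‖var * dilate c hc (shift u)‖ ≤ |c| * (‖shift u‖ + 1) := by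
        rw [Real.norm_eq_abs]; gcongr; linarith
    _ < ‖const u‖ := hcδ

theorem evalAt_eq_const_inverse {t : ℝ} (ht : |t| < 1) (f : Wiener) :
    evalAt t ht.le f = const (Ring.inverse (1 - t • shift) f) := by
  have hu : IsUnit (1 - t • shift : Wiener →L[ℝ] Wiener) := by
    refine isUnit_one_sub_of_norm_lt_one (R := Wiener →L[ℝ] Wiener) ?_
    rw [norm_smul]
    refine lt_of_le_of_lt (mul_le_of_le_one_right (norm_nonneg _) ?_) ht
    exact LinearMap.mkContinuous_norm_le _ zero_le_one _
  have h (g : Wiener) : evalAt t ht.le ((1 - t • shift : Wiener →L[ℝ] Wiener) g) = const g := by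
    have := congrArg (evalAt t ht.le) (eq_const_add_var_mul_shift g)
    simp only [map_add, map_smul, map_one, map_mul, evalAt_var] at this
    simp only [sub_apply, one_apply_eq_self,
      smul_apply, map_sub, map_smul]
    rw [this]
    simp
  rw [← h, ← mul_apply_eq_comp, Ring.mul_inverse_cancel _ hu,
    one_apply_eq_self]

end Wiener

section

open Filter Topology

section FunctionalCalculus

variable {ι : Type*} [Fintype ι] [DecidableEq ι] (A : Type*) [NormedCommRing A] [NormedAlgebra ℝ A]

/-- Extension of scalars of a power series from `ℝ` to a commutative normed algebra. -/
def FormalMultilinearSeries.extendScalars (p : FormalMultilinearSeries ℝ (ι → ℝ) ℝ) :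
    FormalMultilinearSeries ℝ (ι → A) A := fun k =>
  ∑ i : Fin k → ι, p k (fun l => Pi.single (i l) 1) •
    (ContinuousMultilinearMap.mkPiAlgebra ℝ (Fin k) A).compContinuousLinearMap
      fun l => ContinuousLinearMap.proj (i l)

variable {A}

theorem FormalMultilinearSeries.extendScalars_apply (p : FormalMultilinearSeries ℝ (ι → ℝ) ℝ)
    (k : ℕ) (u : Fin k → ι → A) :
    p.extendScalars A k u =
      ∑ i : Fin k → ι, p k (fun l => Pi.single (i l) 1) • ∏ l, u l (i l) := by
  simp [extendScalars]

theorem FormalMultilinearSeries.map_extendScalars (p : FormalMultilinearSeries ℝ (ι → ℝ) ℝ)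
    (φ : A →ₐ[ℝ] ℝ) (k : ℕ) (u : ι → A) :
    φ (p.extendScalars A k fun _ => u) = p k fun _ i => φ (u i) := by
  have h : (fun i => φ (u i)) = ∑ i, φ (u i) • (Pi.single i 1 : ι → ℝ) := by
    ext j
    simp [Finset.sum_apply, Pi.single_apply]
  rw [h, ContinuousMultilinearMap.map_sum, extendScalars_apply, map_sum]
  refine Finset.sum_congr rfl fun i _ => ?_
  rw [ContinuousMultilinearMap.map_smul_univ, map_smul, map_prod, smul_eq_mul, smul_eq_mul,
    mul_comm]

variable [NormOneClass A]

theorem FormalMultilinearSeries.norm_extendScalars_le (p : FormalMultilinearSeries ℝ (ι → ℝ) ℝ)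
    (k : ℕ) : ‖p.extendScalars A k‖ ≤ Fintype.card ι ^ k * ‖p k‖ := by
  refine ContinuousMultilinearMap.opNorm_le_bound (by positivity) fun u => ?_
  rw [extendScalars_apply]
  refine (norm_sum_le _ _).trans ?_
  have h : ∀ i ∈ (Finset.univ : Finset (Fin k → ι)),
      ‖p k (fun l => Pi.single (i l) 1) • ∏ l, u l (i l)‖ ≤ ‖p k‖ * ∏ l, ‖u l‖ := fun i _ => by
    rw [norm_smul]
    gcongr
    · refine ((p k).le_opNorm _).trans_eq ?_
      rw [Finset.prod_eq_one fun l _ => ?_, mul_one]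
      rw [Pi.norm_single, norm_one]
    · exact (Finset.norm_prod_le _ _).trans
        (Finset.prod_le_prod (fun _ _ => norm_nonneg _) fun l _ => norm_le_pi_norm (u l) (i l))
  refine (Finset.sum_le_sum h).trans_eq ?_
  simp [mul_assoc]

theorem FormalMultilinearSeries.extendScalars_radius_pos
    {p : FormalMultilinearSeries ℝ (ι → ℝ) ℝ} (hp : 0 < p.radius) :
    0 < (p.extendScalars A).radius := by
  obtain ⟨C, r, hC, hr, h⟩ := p.le_mul_pow_of_radius_pos hp
  obtain ⟨s, hs'⟩ : ∃ s : NNReal, (s : ℝ) = 1 / (Fintype.card ι * r + 1) :=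
    ⟨⟨_, by positivity⟩, rfl⟩
  have hs : 0 < s := by
    rw [← NNReal.coe_pos, hs']
    positivity
  refine (ENNReal.coe_pos.2 hs).trans_le
    ((p.extendScalars A).le_radius_of_bound C fun n => ?_)
  calc ‖p.extendScalars A n‖ * (s : ℝ) ^ n
      ≤ (Fintype.card ι ^ n * (C * r ^ n)) * (s : ℝ) ^ n := by
        gcongr
        exact (p.norm_extendScalars_le n).trans (by gcongr; exact h n)
    _ = C * ((Fintype.card ι * r) * s) ^ n := by ring
    _ ≤ C * 1 := by
        gcongr
        refine pow_le_one₀ (by positivity) ?_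
        rw [hs', mul_one_div, div_le_one (by positivity)]
        linarith
    _ = C := mul_one C

/-- Analytic functions of finitely many real variables act on commutative Banach algebras,
compatibly with contractive characters. -/
theorem AnalyticAt.exists_extendScalars [CompleteSpace A] {f : (ι → ℝ) → ℝ}
    (hf : AnalyticAt ℝ f 0) :
    ∃ F : (ι → A) → A, AnalyticAt ℝ F 0 ∧ ∀ᶠ u in 𝓝 0, ∀ φ : A →ₐ[ℝ] ℝ,
      (∀ a, |φ a| ≤ ‖a‖) → φ (F u) = f fun i => φ (u i) := by
  obtain ⟨p, r, hp⟩ := hf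
  have hr := p.extendScalars_radius_pos (A := A) (hp.r_pos.trans_le hp.r_le)
  have hP := (p.extendScalars A).hasFPowerSeriesOnBall hr
  refine ⟨_, hP.analyticAt, ?_⟩
  filter_upwards [Metric.eball_mem_nhds (0 : ι → A) hr,
    Metric.eball_mem_nhds (0 : ι → A) hp.r_pos] with u hu1 hu2 φ hφ
  have hφu : (fun i => φ (u i)) ∈ Metric.eball (0 : ι → ℝ) r := by
    rw [mem_eball_zero_iff] at hu2 ⊢
    refine lt_of_le_of_lt ?_ hu2
    rw [enorm_le_iff_norm_le]
    exact (pi_norm_le_iff_of_nonneg (norm_nonneg _)).2 fun i =>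
      (hφ _).trans (norm_le_pi_norm u i)
  have h1 := hP.hasSum hu1
  have h2 := hp.hasSum hφu
  simp only [zero_add] at h1 h2
  have h3 := h1.mapL (LinearMap.mkContinuous φ.toLinearMap 1 (by simpa using hφ))
  refine h3.unique ?_
  convert h2 using 2 with k
  exact p.map_extendScalars φ k u

end FunctionalCalculus

/-- An analytic function of `(x, t)` is an analytic family of power series in `t`. -/
theorem AnalyticAt.exists_wiener {E : Type*} [NormedAddCommGroup E] [NormedSpace ℝ E]
    [FiniteDimensional ℝ E] {f : E × ℝ → ℝ} (hf : AnalyticAt ℝ f 0) :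
    ∃ τ > 0, ∃ F : E → Wiener, AnalyticAt ℝ F 0 ∧ ∀ᶠ x in 𝓝 0,
      ∀ t (ht : |t| ≤ 1), Wiener.evalAt t ht (F x) = f (x, τ * t) := by
  classical
  let b := Module.finBasis ℝ (E × ℝ)
  let e : (E × ℝ) ≃L[ℝ] _ := b.equivFun.toContinuousLinearEquiv
  have hfe : AnalyticAt ℝ (f ∘ e.symm) 0 :=
    AnalyticAt.comp (by simpa using hf) (e.symm.toContinuousLinearMap.analyticAt 0)
  obtain ⟨G, hG, hGe⟩ := hfe.exists_extendScalars (A := Wiener)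
  let u (τ : ℝ) (x : E) : Fin (Module.finrank ℝ (E × ℝ)) → Wiener := fun i =>
    e (x, 0) i • 1 + e (0, τ) i • Wiener.var
  have hu : Continuous fun y : ℝ × E => u y.1 y.2 := by fun_prop
  have hu0 : u 0 0 = 0 := by
    ext1 i
    have : ((0 : E), (0 : ℝ)) = 0 := rfl
    simp [u, this]
  have hev : ∀ᶠ y : ℝ × E in 𝓝 (0, 0), AnalyticAt ℝ G (u y.1 y.2) ∧
      ∀ φ : Wiener →ₐ[ℝ] ℝ, (∀ a, |φ a| ≤ ‖a‖) →
        φ (G (u y.1 y.2)) = (f ∘ e.symm) fun i => φ (u y.1 y.2 i) := by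
    refine hu.continuousAt.eventually (p := fun v => AnalyticAt ℝ G v ∧ ∀ φ : Wiener →ₐ[ℝ] ℝ,
      (∀ a, |φ a| ≤ ‖a‖) → φ (G v) = (f ∘ e.symm) fun i => φ (v i)) ?_
    simp only [hu0]
    exact hG.eventually_analyticAt.and hGe
  rw [nhds_prod_eq] at hev
  have hev' := hev.curry
  obtain ⟨τ, hτ, hτ0⟩ :=
    ((hev'.filter_mono (nhdsWithin_le_nhds (s := Set.Ioi 0))).and self_mem_nhdsWithin).exists
  refine ⟨τ, hτ0, fun x => G (u τ x), ?_, ?_⟩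
  · refine AnalyticAt.fun_comp hτ.self_of_nhds.1 ?_
    rw [analyticAt_pi_iff]
    intro i
    have : AnalyticAt ℝ (fun x : E => e (x, 0) i) 0 :=
      ((ContinuousLinearMap.proj (R := ℝ) i).comp
        (e.toContinuousLinearMap.comp (ContinuousLinearMap.inl ℝ E ℝ))).analyticAt 0
    exact (this.smul analyticAt_const).add analyticAt_const
  · filter_upwards [hτ] with x hx t ht
    rw [hx.2 _ (Wiener.abs_evalAt_le ht), Function.comp_apply]
    congr 1
    rw [ContinuousLinearEquiv.symm_apply_eq]
    ext i
    have : e (x, τ * t) = e (x, 0) + t • e (0, τ) := by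
      rw [← map_smul, ← map_add]
      simp [mul_comm]
    rw [this]
    simp [u, mul_comm]

end

section WeierstrassDivision

open Filter Topology

variable {E : Type*} [NormedAddCommGroup E] [NormedSpace ℝ E]

theorem ContinuousAt.eventually_isUnit {X A : Type*} [TopologicalSpace X]
    [NormedAddCommGroup A] [NormedSpace ℝ A] [CompleteSpace A] {I : X → (A →L[ℝ] A)} {z : X}
    (hI : ContinuousAt I z) (hu : IsUnit (I z)) : ∀ᶠ x in 𝓝 z, IsUnit (I x) := by
  obtain ⟨m, hm⟩ := hu
  have h : ∀ᶠ y in 𝓝 (m : A →L[ℝ] A), IsUnit y := Units.nhds m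
  exact hI.eventually (hm ▸ h)

theorem AnalyticAt.ringInverse_apply {A : Type*} [NormedAddCommGroup A] [NormedSpace ℝ A]
    [CompleteSpace A] {I : E → (A →L[ℝ] A)} {v : E → A} {z : E} (hI : AnalyticAt ℝ I z)
    (hu : IsUnit (I z)) (hv : AnalyticAt ℝ v z) :
    AnalyticAt ℝ (fun x => Ring.inverse (I x) (v x)) z := by
  have hinv : AnalyticAt ℝ (fun x => Ring.inverse (I x)) z := by
    refine AnalyticAt.fun_comp (g := Ring.inverse) ?_ hI
    obtain ⟨m, hm⟩ := hu
    rw [← hm]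
    exact analyticAt_inverse (𝕜 := ℝ) (A := A →L[ℝ] A) m
  exact ((ContinuousLinearMap.id ℝ (A →L[ℝ] A)).analyticAt_bilinear
    (Ring.inverse (I z), v z)).fun_comp (g := fun p : (A →L[ℝ] A) × A => p.1 p.2)
    (f := fun x => (Ring.inverse (I x), v x)) (hinv.prod hv)

/-- Weierstrass division in families of power series. -/
theorem Wiener.exists_division {F G : E → Wiener} (hF : AnalyticAt ℝ F 0)
    (hG : AnalyticAt ℝ G 0) {d : ℕ} {u : Wiener} (hGu : G 0 = var ^ d * u) (hu : IsUnit u) :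
    ∃ (Q : E → Wiener) (R : ℕ → E → ℝ), AnalyticAt ℝ Q 0 ∧ (∀ j, AnalyticAt ℝ (R j) 0) ∧
      u * Q 0 = shift^[d] (F 0) ∧
      ∀ᶠ x in 𝓝 0, F x = G x * Q x + ∑ j ∈ Finset.range d, R j x • var ^ j := by
  have hpow (j : ℕ) (a : Wiener) : (shift ^ j : Wiener →L[ℝ] Wiener) a = shift^[j] a := by
    induction j generalizing a with
    | zero => rfl
    | succ j ih => rw [pow_succ, mul_apply_eq_comp, ih, Function.iterate_succ_apply]
  let M : E → (Wiener →L[ℝ] Wiener) := fun x =>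
    (shift ^ d : Wiener →L[ℝ] Wiener) * ContinuousLinearMap.mul ℝ Wiener (G x)
  have hM : AnalyticAt ℝ M 0 :=
    analyticAt_const.mul (((ContinuousLinearMap.mul ℝ Wiener).analyticAt _).fun_comp hG)
  have hMapply (x : E) (a : Wiener) : M x a = shift^[d] (G x * a) := by
    rw [← hpow]; rfl
  have hM0 : IsUnit (M 0) := by
    obtain ⟨v, rfl⟩ := hu
    refine ⟨⟨M 0, ContinuousLinearMap.mul ℝ Wiener ↑v⁻¹, ?_, ?_⟩, rfl⟩ <;> ext1 a <;>
      rw [mul_apply_eq_comp, hMapply, hGu, mul_assoc, iterate_shift_var_pow_mul] <;> simp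
  let Q : E → Wiener := fun x => Ring.inverse (M x) ((shift ^ d : Wiener →L[ℝ] Wiener) (F x))
  have hQ : AnalyticAt ℝ Q 0 :=
    hM.ringInverse_apply hM0 (((shift ^ d : Wiener →L[ℝ] Wiener).analyticAt _).fun_comp hF)
  have hMQ (x : E) (hx : IsUnit (M x)) : shift^[d] (G x * Q x) = shift^[d] (F x) := by
    rw [← hMapply, ← hpow, ← mul_apply_eq_comp, Ring.mul_inverse_cancel _ hx,
      one_apply_eq_self]
  refine ⟨Q, fun j x => const ((shift ^ j : Wiener →L[ℝ] Wiener) (F x - G x * Q x)), hQ,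
    fun j => ((const.comp (shift ^ j : Wiener →L[ℝ] Wiener)).analyticAt _).fun_comp
      (hF.sub (hG.mul hQ)), ?_, ?_⟩
  · rw [← hMQ 0 hM0, hGu, mul_assoc, iterate_shift_var_pow_mul]
  · have hev : ∀ᶠ x in 𝓝 0, IsUnit (M x) :=
      hM.continuousAt.eventually_isUnit hM0
    filter_upwards [hev] with x hx
    have h := eq_sum_add_var_pow_mul d (F x - G x * Q x)
    rw [← hpow d, map_sub, hpow, hpow, hMQ x hx, sub_self, mul_zero, add_zero] at h
    simp only [hpow]
    rw [← h]
    ring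

/-- A pair of families of power series yields a division formula for the functions they sum to. -/
theorem exists_division_of_wiener {f g : E × ℝ → ℝ} {F G : E → Wiener} (hF : AnalyticAt ℝ F 0)
    (hG : AnalyticAt ℝ G 0) {d : ℕ} {u : Wiener} (hGu : G 0 = Wiener.var ^ d * u)
    (hu : IsUnit u) {τ : ℝ} (hτ : 0 < τ)
    (hf : ∀ᶠ x in 𝓝 0, ∀ t (ht : |t| ≤ 1), Wiener.evalAt t ht (F x) = f (x, τ * t))
    (hg : ∀ᶠ x in 𝓝 0, ∀ t (ht : |t| ≤ 1), Wiener.evalAt t ht (G x) = g (x, τ * t)) :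
    ∃ (q : E × ℝ → ℝ) (r : ℕ → E → ℝ), AnalyticAt ℝ q 0 ∧ (∀ j, AnalyticAt ℝ (r j) 0) ∧
      Wiener.const u * q 0 = Wiener.const (Wiener.shift^[d] (F 0)) ∧
      ∀ᶠ z in 𝓝 0, f z = g z * q z + ∑ j ∈ Finset.range d, r j z.1 * z.2 ^ j := by
  obtain ⟨Q, R, hQ, hR, hQ0, hdiv⟩ := Wiener.exists_division hF hG hGu hu
  let I : E × ℝ → (Wiener →L[ℝ] Wiener) := fun z => 1 - (z.2 / τ) • Wiener.shift
  have hI : AnalyticAt ℝ I 0 :=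
    analyticAt_const.sub ((analyticAt_snd.div_const).smul analyticAt_const)
  have hI0 : I 0 = 1 := by
    simp only [I, Prod.snd_zero, zero_div]
    rw [zero_smul ℝ Wiener.shift, sub_zero]
  refine ⟨fun z => Wiener.const (Ring.inverse (I z) (Q z.1)), fun j x => R j x / τ ^ j,
    (Wiener.const.analyticAt _).fun_comp 
      (hI.ringInverse_apply (hI0 ▸ isUnit_one) (hQ.comp_of_eq analyticAt_fst rfl)),
    fun j => (hR j).div_const, ?_, ?_⟩
  · simp only [hI0, Ring.inverse_one, one_apply_eq_self, Prod.fst_zero]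
    rw [← Wiener.const_mul, hQ0]
  · have hfst : Tendsto (Prod.fst : E × ℝ → E) (𝓝 0) (𝓝 0) := continuous_fst.tendsto 0
    have hsnd : Tendsto (fun z : E × ℝ => |z.2 / τ|) (𝓝 0) (𝓝 0) := by
      have : Continuous fun z : E × ℝ => |z.2 / τ| := by fun_prop
      simpa using this.tendsto 0
    filter_upwards [hfst.eventually hf, hfst.eventually hg, hfst.eventually hdiv,
      hsnd.eventually (gt_mem_nhds one_pos)] with z hfz hgz hdz hz
    have h := congrArg (Wiener.evalAt (z.2 / τ) hz.le) hdz
    have hz' : (z.1, τ * (z.2 / τ)) = z := by rw [mul_div_cancel₀ _ hτ.ne']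
    rw [map_add, map_mul, hfz, hgz, hz', Wiener.evalAt_eq_const_inverse hz, map_sum] at h
    rw [h]
    congr 1
    refine Finset.sum_congr rfl fun j _ => ?_
    rw [map_smul, map_pow, Wiener.evalAt_var, smul_eq_mul]
    ring

variable [FiniteDimensional ℝ E]

/-- Weierstrass division and preparation for real analytic germs. -/
theorem AnalyticAt.exists_weierstrass {g : E × ℝ → ℝ} (hg : AnalyticAt ℝ g 0)
    (hg0 : ¬ ∀ᶠ t in 𝓝 (0 : ℝ), g (0, t) = 0) :
    ∃ d : ℕ,
      (∀ f : E × ℝ → ℝ, AnalyticAt ℝ f 0 → ∃ (q : E × ℝ → ℝ) (r : ℕ → E → ℝ),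
        AnalyticAt ℝ q 0 ∧ (∀ j, AnalyticAt ℝ (r j) 0) ∧
        ∀ᶠ z in 𝓝 0, f z = g z * q z + ∑ j ∈ Finset.range d, r j z.1 * z.2 ^ j) ∧
      ∃ (q : E × ℝ → ℝ) (r : ℕ → E → ℝ),
        AnalyticAt ℝ q 0 ∧ (∀ j, AnalyticAt ℝ (r j) 0) ∧ q 0 ≠ 0 ∧
        ∀ᶠ z in 𝓝 0, z.2 ^ d = g z * q z + ∑ j ∈ Finset.range d, r j z.1 * z.2 ^ j := by
  obtain ⟨τg, hτg, G, hG, hGg⟩ := hg.exists_wiener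
  have hG0 : G 0 ≠ 0 := by
    intro h0
    apply hg0
    have hsmall : ∀ᶠ t in 𝓝 (0 : ℝ), |t / τg| < 1 := by
      have : Continuous fun t : ℝ => |t / τg| := by fun_prop
      exact this.continuousAt.eventually (gt_mem_nhds (by simp))
    filter_upwards [hsmall] with t ht
    have := hGg.self_of_nhds (t / τg) ht.le
    rw [h0, map_zero, mul_div_cancel₀ _ hτg.ne'] at this
    exact this.symm
  obtain ⟨d, u, hdu, hu⟩ := Wiener.exists_eq_var_pow_mul hG0
  obtain ⟨δ, hδ, hδu⟩ := Wiener.exists_isUnit_dilate hu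
  have key {τ : ℝ} (hτ : 0 < τ) {τ' : ℝ} (hτ' : 0 < τ') (hle : τ ≤ τ') {f : E × ℝ → ℝ}
      {F : E → Wiener} (hF : AnalyticAt ℝ F 0)
      (hf : ∀ᶠ x in 𝓝 0, ∀ t (ht : |t| ≤ 1), Wiener.evalAt t ht (F x) = f (x, τ' * t)) :
      ∃ hc : |τ / τ'| ≤ 1, AnalyticAt ℝ (fun x => Wiener.dilate (τ / τ') hc (F x)) 0 ∧
        ∀ᶠ x in 𝓝 0, ∀ t (ht : |t| ≤ 1),
          Wiener.evalAt t ht (Wiener.dilate (τ / τ') hc (F x)) = f (x, τ * t) := by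
    have hc : |τ / τ'| ≤ 1 := by
      rw [abs_of_pos (by positivity)]
      exact (div_le_one hτ').2 hle
    refine ⟨hc, ((Wiener.dilate _ hc).analyticAt _).fun_comp hF, ?_⟩
    filter_upwards [hf] with x hx t ht
    have hct : |τ / τ' * t| ≤ 1 := by
      rw [abs_mul]
      exact mul_le_one₀ hc (abs_nonneg _) ht
    rw [Wiener.evalAt_dilate hc ht hct, hx]
    congr 2
    field_simp
  have main {τ : ℝ} (hτ : 0 < τ) (hle : τ ≤ τg) (hlt : τ / τg < δ) {f : E × ℝ → ℝ}
      {F : E → Wiener} (hF : AnalyticAt ℝ F 0)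
      (hf : ∀ᶠ x in 𝓝 0, ∀ t (ht : |t| ≤ 1), Wiener.evalAt t ht (F x) = f (x, τ * t)) :
      ∃ (q : E × ℝ → ℝ) (r : ℕ → E → ℝ), AnalyticAt ℝ q 0 ∧ (∀ j, AnalyticAt ℝ (r j) 0) ∧
        (Wiener.const (Wiener.shift^[d] (F 0)) ≠ 0 → q 0 ≠ 0) ∧
        ∀ᶠ z in 𝓝 0, f z = g z * q z + ∑ j ∈ Finset.range d, r j z.1 * z.2 ^ j := by
    obtain ⟨hc, hG', hg'⟩ := key hτ hτg hle hG hGg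
    have hunit : IsUnit ((τ / τg) ^ d • Wiener.dilate (τ / τg) hc u) := by
      rw [Algebra.smul_def]
      refine ((isUnit_iff_ne_zero.2 (by positivity)).map (algebraMap ℝ Wiener)).mul
        (hδu _ hc ?_)
      rwa [abs_of_pos (by positivity)]
    obtain ⟨q, r, hq, hr, hq0, hqr⟩ := exists_division_of_wiener hF hG'
      (d := d) (u := (τ / τg) ^ d • Wiener.dilate (τ / τg) hc u)
      (by rw [hdu, Wiener.dilate_mul, Wiener.dilate_var_pow, smul_mul_assoc, mul_smul_comm])
      hunit hτ hf hg'
    exact ⟨q, r, hq, hr, fun h h0 => h (by rw [← hq0, h0, mul_zero]), hqr⟩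
  refine ⟨d, fun f hf => ?_, ?_⟩
  · obtain ⟨τf, hτf, F, hF, hFf⟩ := hf.exists_wiener
    obtain ⟨τ, hτ, h1, h2, h3⟩ : ∃ τ > 0, τ ≤ τg ∧ τ ≤ τf ∧ τ / τg < δ := by
      refine ⟨min (min τg τf) (τg * δ / 2), by positivity, ?_, ?_, ?_⟩
      · exact (min_le_left _ _).trans (min_le_left _ _)
      · exact (min_le_left _ _).trans (min_le_right _ _)
      · rw [div_lt_iff₀ hτg]
        refine (min_le_right _ _).trans_lt ?_
        have := mul_pos hτg hδ
        linarith
    obtain ⟨hc, hF', hf'⟩ := key hτ hτf h2 hF hFf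
    obtain ⟨q, r, hq, hr, -, hqr⟩ := main hτ h1 h3 hF' hf'
    exact ⟨q, r, hq, hr, hqr⟩
  · obtain ⟨τ, hτ, h1, h3⟩ : ∃ τ > 0, τ ≤ τg ∧ τ / τg < δ := by
      refine ⟨min τg (τg * δ / 2), by positivity, min_le_left _ _, ?_⟩
      rw [div_lt_iff₀ hτg]
      refine (min_le_right _ _).trans_lt ?_
      have := mul_pos hτg hδ
      linarith
    obtain ⟨q, r, hq, hr, hq0, hqr⟩ := main hτ h1 h3 (f := fun z => z.2 ^ d)
      (F := fun _ => Wiener.var ^ d * τ ^ d • 1) analyticAt_const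
      (Eventually.of_forall fun x t ht => by simp [mul_pow])
    refine ⟨q, r, hq, hr, hq0 ?_, hqr⟩
    rw [Wiener.iterate_shift_var_pow_mul, map_smul]
    simp [Wiener.const, hτ.ne']

end WeierstrassDivision

/-- Every extension of fields of characteristic zero is formally smooth. -/
theorem Algebra.FormallySmooth.of_charZero (K L : Type*) [Field K] [CharZero K] [Field L]
    [Algebra K L] : Algebra.FormallySmooth K L := by
  obtain ⟨s, hs⟩ := exists_isTranscendenceBasis K L
  have hv : IsTranscendenceBasis K ((↑) : s → L) := hs
  have := hv.isAlgebraic_field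
  exact .of_algebraicIndependent_of_isSeparable hv.1

/-- A domain of characteristic zero that embeds into a field is formally smooth below it. -/
theorem Algebra.FormallySmooth.of_faithfulSMul_of_charZero (B L : Type*) [CommRing B]
    [CharZero B] [Field L] [Algebra B L] [FaithfulSMul B L] : Algebra.FormallySmooth B L := by
  have : IsDomain B := (FaithfulSMul.algebraMap_injective B L).isDomain
  let := FractionRing.liftAlgebra B L
  have := FractionRing.isScalarTower_liftAlgebra B L
  have : CharZero (FractionRing B) := charZero_of_injective_algebraMap
    (IsFractionRing.injective B (FractionRing B))
  have := Algebra.FormallySmooth.of_charZero (FractionRing B) L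
  have : Algebra.FormallySmooth B (FractionRing B) := .of_isLocalization (nonZeroDivisors B)
  exact .comp B (FractionRing B) L

section

variable {k S L : Type*} [Field k] [CharZero k] [CommRing S] [Algebra k S] [Field L] [Algebra k L]

/-- A partial section of an infinitesimal extension of a field of characteristic zero extends to
a section. -/
theorem AlgHom.exists_section_of_subalgebra (g : S →ₐ[k] L) (hg : Function.Surjective g)
    (hker : IsNilpotent (RingHom.ker g)) (B : Subalgebra k S)
    (hB : ∀ b ∈ B, g b = 0 → b = 0) :
    ∃ l : L →ₐ[k] S, (∀ y, g (l y) = y) ∧ ∀ b ∈ B, l (g b) = b := by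
  let : Algebra B L := (g.comp B.val).toRingHom.toAlgebra
  have hmap (b : B) : algebraMap B L b = g b := rfl
  have : FaithfulSMul B L := (faithfulSMul_iff_algebraMap_injective B L).2 <|
    (injective_iff_map_eq_zero _).2 fun b hb => Subtype.ext (hB b b.2 hb)
  have : IsScalarTower k B L := .of_algebraMap_eq fun c => (g.commutes c).symm
  have : CharZero B := charZero_of_injective_ringHom (R := k) (f := algebraMap k B) <|
    .of_comp (f := algebraMap B L) <| by
      rw [← RingHom.coe_comp, ← IsScalarTower.algebraMap_eq]
      exact (algebraMap k L).injective
  have := Algebra.FormallySmooth.of_faithfulSMul_of_charZero B L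
  let g' : S →ₐ[B] L := { g.toRingHom with commutes' := fun b => rfl }
  let l := Algebra.FormallySmooth.liftOfSurjective (AlgHom.id B L) g' hg hker
  refine ⟨l.restrictScalars k, fun y =>
    Algebra.FormallySmooth.liftOfSurjective_apply (AlgHom.id B L) g' hg hker y, fun b hb => ?_⟩
  exact l.commutes ⟨b, hb⟩

/-- A derivation defined on a subring extends to the ambient field of characteristic zero. -/
theorem exists_derivation_of_algHom {A : Type*} [CommRing A] [Algebra k A]
    (h : A →ₐ[k] TrivSqZeroExt L L) (hk : ∀ a, (h a).fst = 0 → (h a).snd = 0) :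
    ∃ D : Derivation k L L, ∀ a, D (h a).fst = (h a).snd := by
  obtain ⟨l, hl, hlB⟩ := AlgHom.exists_section_of_subalgebra (TrivSqZeroExt.fstHom k L L)
    TrivSqZeroExt.fst_surjective ⟨2, TrivSqZeroExt.kerIdeal_sq L L⟩ h.range (by
      rintro _ ⟨a, rfl⟩ ha
      exact TrivSqZeroExt.ext ha (hk a ha))
  refine ⟨Derivation.mk' ((TrivSqZeroExt.sndHom L L).restrictScalars k ∘ₗ l.toLinearMap) ?_, ?_⟩
  · intro a b
    have hl' (y : L) : (l y).fst = y := hl y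
    simp [hl', mul_comm b]
  · intro a
    exact congrArg TrivSqZeroExt.snd (hlB _ ⟨a, rfl⟩)

end

section AlgebraicDerivation

open Polynomial

variable {k L : Type*} [Field k] [Field L] [Algebra k L]

/-- Differentiating the value of a polynomial whose coefficients lie in a differential
subfield. -/
theorem Derivation.exists_apply_aeval {K : IntermediateField k L} {D : Derivation k L L}
    (hD : ∀ y ∈ K, D y ∈ K) (s : L) (p : K[X]) :
    ∃ q : K[X], (∀ i, (q.coeff i : L) = D (p.coeff i)) ∧
      D (aeval s p) = aeval s q + aeval s (derivative p) * D s := by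
  induction p using Polynomial.induction_on' with
  | add p₁ p₂ h₁ h₂ =>
    obtain ⟨q₁, hq₁, e₁⟩ := h₁
    obtain ⟨q₂, hq₂, e₂⟩ := h₂
    refine ⟨q₁ + q₂, fun i => by simp [hq₁, hq₂], ?_⟩
    simp only [map_add, e₁, e₂]
    ring
  | monomial n a =>
    refine ⟨monomial n ⟨D a, hD _ a.2⟩, fun i => ?_, ?_⟩
    · simp only [coeff_monomial]
      split_ifs <;> simp
    · simp only [aeval_monomial, derivative_monomial, D.leibniz, D.leibniz_pow,
        IntermediateField.algebraMap_apply, smul_eq_mul, nsmul_eq_mul]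
      push_cast
      ring

variable {K : IntermediateField k L} {D : Derivation k L L}

/-- A derivation preserving a subfield preserves its algebraic extensions of characteristic
zero. -/
theorem Derivation.apply_mem_adjoin_of_isIntegral [CharZero k] (hD : ∀ y ∈ K, D y ∈ K) {s : L}
    (hs : IsIntegral K s) {K' : IntermediateField k L} (hK : K ≤ K') (hsK : s ∈ K') :
    D s ∈ K' := by
  have hmem (p : K[X]) : aeval s p ∈ K' := by
    rw [aeval_eq_sum_range]
    exact sum_mem fun i _ => by
      rw [Algebra.smul_def]
      exact mul_mem (hK (p.coeff i).2) (pow_mem hsK i)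
  obtain ⟨q, -, hq⟩ := D.exists_apply_aeval hD s (minpoly K s)
  have : CharZero K := charZero_of_injective_algebraMap (algebraMap k K).injective
  have hsep : aeval s (derivative (minpoly K s)) ≠ 0 :=
    (minpoly.irreducible hs).separable.aeval_derivative_ne_zero (minpoly.aeval K s)
  rw [minpoly.aeval, map_zero] at hq
  have : D s = -aeval s q / aeval s (derivative (minpoly K s)) := by
    rw [eq_div_iff hsep]
    linear_combination -hq
  rw [this]
  exact div_mem (neg_mem (hmem _)) (hmem _)

/-- An algebraic element is not a constant if some coefficient of its minimal polynomial is not a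
constant. -/
theorem Derivation.apply_ne_zero_of_isIntegral (hD : ∀ y ∈ K, D y ∈ K) {r : L}
    (hr : IsIntegral K r) {j : ℕ} (hj : D ((minpoly K r).coeff j) ≠ 0) : D r ≠ 0 := by
  intro h0
  obtain ⟨q, hqc, hq⟩ := D.exists_apply_aeval hD r (minpoly K r)
  rw [minpoly.aeval, map_zero, h0, mul_zero, add_zero] at hq
  have hq0 : q ≠ 0 := by
    rintro rfl
    exact hj (by simpa using (hqc j).symm)
  have hle := minpoly.degree_le_of_ne_zero K r hq0 hq.symm
  refine absurd hle (not_le.2 ?_)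
  rw [degree_eq_natDegree (minpoly.ne_zero hr), degree_lt_iff_coeff_zero]
  intro i hi
  have h1 := hqc i
  obtain rfl | hlt := hi.eq_or_lt
  · rw [coeff_natDegree, minpoly.monic hr] at h1
    simpa using h1
  · rw [coeff_eq_zero_of_natDegree_lt hlt] at h1
    simpa using h1

/-- An element that is algebraic over `K` and transcendental over `k` has a minimal polynomial
over `K` with a transcendental coefficient. -/
theorem exists_transcendental_coeff_minpoly {r : L} (hr : IsIntegral K r)
    (ht : Transcendental k r) : ∃ j, Transcendental k ((minpoly K r).coeff j : L) := by
  by_contra! h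
  apply ht
  simp only [Transcendental, not_not] at h
  have hl : (minpoly K r).map (algebraMap K L) ∈
      lifts (algebraMap (algebraicClosure k L) L) := by
    rw [lifts_iff_coeff_lifts]
    intro i
    rw [coeff_map]
    exact ⟨⟨_, mem_algebraicClosure_iff.2 (h i)⟩, rfl⟩
  obtain ⟨P, hP⟩ := hl
  have hP' : P.map (algebraMap (algebraicClosure k L) L) = (minpoly K r).map (algebraMap K L) := hP
  have hP0 : P ≠ 0 := by
    rintro rfl
    rw [Polynomial.map_zero] at hP'
    exact (((minpoly.monic hr).map (algebraMap K L)).ne_zero) hP'.symm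
  have halg : IsAlgebraic (algebraicClosure k L) r := by
    refine ⟨P, hP0, ?_⟩
    rw [← eval_map_algebraMap, hP', eval_map_algebraMap, minpoly.aeval]
  exact halg.restrictScalars k

end AlgebraicDerivation

section SequenceGerms

open Filter Topology

variable {L : Type*} [Field L] [Algebra ℝ L] (π : (ℕ → ℝ) →ₐ[ℝ] L)
variable {E : Type*} [NormedAddCommGroup E] [NormedSpace ℝ E]

/-- The functions that are analytic at the origin. -/
def analyticSubalgebra (E : Type*) [NormedAddCommGroup E] [NormedSpace ℝ E] :
    Subalgebra ℝ (E → ℝ) where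
  carrier := {f | AnalyticAt ℝ f 0}
  mul_mem' hf hg := AnalyticAt.mul hf hg
  add_mem' hf hg := AnalyticAt.add hf hg
  algebraMap_mem' c := analyticAt_const (v := c)

/-- The generic value along a sequence. -/
def valueAlong {E : Type*} (x : ℕ → E) : (E → ℝ) →ₐ[ℝ] L :=
  π.comp (AlgHom.pi fun n : ℕ => Pi.evalAlgHom ℝ (fun _ : E => ℝ) (x n))

theorem valueAlong_apply {E : Type*} (x : ℕ → E) (f : E → ℝ) :
    valueAlong π x f = π fun n => f (x n) := rfl

/-- The field generated by the generic values along a sequence of analytic functions. -/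
def germField (x : ℕ → E) : IntermediateField ℝ L :=
  IntermediateField.adjoin ℝ ((analyticSubalgebra E).map (valueAlong π x) : Set L)

/-- The generic value along a sequence of the derivative in the directions `w`. -/
def derivAlong (x w : ℕ → E) (f : E → ℝ) : L := π fun n => fderiv ℝ f (x n) (w n)

variable {π} {x w : ℕ → E} {f g : E → ℝ}

theorem valueAlong_mem_germField (hf : AnalyticAt ℝ f 0) : valueAlong π x f ∈ germField π x :=
  IntermediateField.subset_adjoin _ _ ⟨f, hf, rfl⟩

theorem germField_le {K : IntermediateField ℝ L}
    (h : ∀ f : E → ℝ, AnalyticAt ℝ f 0 → valueAlong π x f ∈ K) : germField π x ≤ K := by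
  rw [germField, IntermediateField.adjoin_le_iff]
  rintro _ ⟨f, hf, rfl⟩
  exact h f hf

theorem exists_eq_div_of_mem_germField {r : L} (hr : r ∈ germField π x) :
    ∃ a b : E → ℝ, AnalyticAt ℝ a 0 ∧ AnalyticAt ℝ b 0 ∧
      r = valueAlong π x a / valueAlong π x b := by
  rw [germField, IntermediateField.mem_adjoin_iff_div, Algebra.adjoin_eq] at hr
  obtain ⟨_, ⟨a, ha, rfl⟩, _, ⟨b, hb, rfl⟩, h⟩ := hr
  exact ⟨a, b, ha, hb, h⟩

theorem Derivation.apply_mem_germField {D : Derivation ℝ L L}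
    (h : ∀ f : E → ℝ, AnalyticAt ℝ f 0 → D (valueAlong π x f) ∈ germField π x) :
    ∀ y ∈ germField π x, D y ∈ germField π x := by
  intro y hy
  obtain ⟨a, b, ha, hb, rfl⟩ := exists_eq_div_of_mem_germField hy
  rw [D.leibniz_div]
  have hva := valueAlong_mem_germField (π := π) (x := x) ha
  have hvb := valueAlong_mem_germField (π := π) (x := x) hb
  simp only [smul_eq_mul]
  exact mul_mem (pow_mem (inv_mem hvb) 2)
    (sub_mem (mul_mem hvb (h a ha)) (mul_mem hva (h b hb)))

theorem AlgHom.congr_of_eventuallyEq (h0 : ∀ f : ℕ → ℝ, f =ᶠ[atTop] 0 → π f = 0)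
    {a b : ℕ → ℝ} (hab : a =ᶠ[atTop] b) : π a = π b := by
  rw [← sub_eq_zero, ← map_sub]
  exact h0 _ (hab.mono fun n hn => by simp [hn])

theorem AlgHom.ne_zero_of_eventually_ne (h0 : ∀ f : ℕ → ℝ, f =ᶠ[atTop] 0 → π f = 0)
    {a : ℕ → ℝ} (ha : ∀ᶠ n in atTop, a n ≠ 0) : π a ≠ 0 := by
  intro h
  have h1 : π (a * a⁻¹) = π 1 :=
    AlgHom.congr_of_eventuallyEq h0 (ha.mono fun n hn => mul_inv_cancel₀ hn)
  rw [map_mul, h, zero_mul, map_one] at h1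
  exact zero_ne_one h1

theorem valueAlong_congr {E : Type*} [TopologicalSpace E] [Zero E] {x : ℕ → E}
    {f g : E → ℝ} (h0 : ∀ f : ℕ → ℝ, f =ᶠ[atTop] 0 → π f = 0)
    (hx : Tendsto x atTop (𝓝 0)) (h : f =ᶠ[𝓝 0] g) :
    valueAlong π x f = valueAlong π x g :=
  AlgHom.congr_of_eventuallyEq h0 (hx.eventually h)

theorem valueAlong_ne_zero {E : Type*} [TopologicalSpace E] [Zero E] {x : ℕ → E}
    {f : E → ℝ} (h0 : ∀ f : ℕ → ℝ, f =ᶠ[atTop] 0 → π f = 0)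
    (hx : Tendsto x atTop (𝓝 0)) (hf : ContinuousAt f 0) (hf0 : f 0 ≠ 0) :
    valueAlong π x f ≠ 0 :=
  AlgHom.ne_zero_of_eventually_ne h0 (hx.eventually (hf.eventually_ne hf0))

theorem derivAlong_congr (h0 : ∀ f : ℕ → ℝ, f =ᶠ[atTop] 0 → π f = 0)
    (hx : Tendsto x atTop (𝓝 0)) (h : f =ᶠ[𝓝 0] g) :
    derivAlong π x w f = derivAlong π x w g :=
  AlgHom.congr_of_eventuallyEq h0 <| (hx.eventually (h.fderiv (𝕜 := ℝ))).mono fun n hn => by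
    simp only [hn]

theorem derivAlong_add (h0 : ∀ f : ℕ → ℝ, f =ᶠ[atTop] 0 → π f = 0)
    (hx : Tendsto x atTop (𝓝 0)) (hf : AnalyticAt ℝ f 0) (hg : AnalyticAt ℝ g 0) :
    derivAlong π x w (f + g) = derivAlong π x w f + derivAlong π x w g := by
  rw [derivAlong, derivAlong, derivAlong, ← map_add]
  refine AlgHom.congr_of_eventuallyEq h0 ?_
  filter_upwards [hx.eventually hf.eventually_analyticAt,
    hx.eventually hg.eventually_analyticAt] with n hfn hgn
  rw [fderiv_add hfn.differentiableAt hgn.differentiableAt]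
  rfl

theorem derivAlong_mul (h0 : ∀ f : ℕ → ℝ, f =ᶠ[atTop] 0 → π f = 0)
    (hx : Tendsto x atTop (𝓝 0)) (hf : AnalyticAt ℝ f 0) (hg : AnalyticAt ℝ g 0) :
    derivAlong π x w (f * g) =
      valueAlong π x f * derivAlong π x w g + valueAlong π x g * derivAlong π x w f := by
  rw [derivAlong, derivAlong, derivAlong, valueAlong_apply, valueAlong_apply, ← map_mul,
    ← map_mul, ← map_add]
  refine AlgHom.congr_of_eventuallyEq h0 ?_
  filter_upwards [hx.eventually hf.eventually_analyticAt,
    hx.eventually hg.eventually_analyticAt] with n hfn hgn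
  rw [fderiv_mul hfn.differentiableAt hgn.differentiableAt]
  rfl

theorem derivAlong_algebraMap (h0 : ∀ f : ℕ → ℝ, f =ᶠ[atTop] 0 → π f = 0) (c : ℝ) :
    derivAlong π x w (algebraMap ℝ (E → ℝ) c) = 0 := by
  refine h0 _ (Eventually.of_forall fun n => ?_)
  have : algebraMap ℝ (E → ℝ) c = fun _ => c := rfl
  simp [this]

/-- The functions that a derivation `D` differentiates in the directions `w`. -/
def differentiatedSubalgebra (h0 : ∀ f : ℕ → ℝ, f =ᶠ[atTop] 0 → π f = 0)
    (hx : Tendsto x atTop (𝓝 0)) (D : Derivation ℝ L L) (w : ℕ → E) :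
    Subalgebra ℝ (E → ℝ) where
  carrier := {f | AnalyticAt ℝ f 0 ∧ D (valueAlong π x f) = derivAlong π x w f}
  mul_mem' := by
    rintro f g ⟨hf, hf'⟩ ⟨hg, hg'⟩
    refine ⟨hf.mul hg, ?_⟩
    rw [derivAlong_mul h0 hx hf hg, map_mul, D.leibniz, hf', hg', smul_eq_mul, smul_eq_mul]
  add_mem' := by
    rintro f g ⟨hf, hf'⟩ ⟨hg, hg'⟩
    refine ⟨hf.add hg, ?_⟩
    rw [derivAlong_add h0 hx hf hg, map_add, map_add, hf', hg']
  algebraMap_mem' c := by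
    refine ⟨analyticAt_const (v := c), ?_⟩
    rw [derivAlong_algebraMap h0, AlgHom.commutes, D.map_algebraMap]

theorem mem_differentiatedSubalgebra_congr (h0 : ∀ f : ℕ → ℝ, f =ᶠ[atTop] 0 → π f = 0)
    (hx : Tendsto x atTop (𝓝 0)) {D : Derivation ℝ L L} (h : f =ᶠ[𝓝 0] g)
    (hf : f ∈ differentiatedSubalgebra h0 hx D w) : g ∈ differentiatedSubalgebra h0 hx D w :=
  ⟨hf.1.congr h, by
    rw [← valueAlong_congr h0 hx h, ← derivAlong_congr h0 hx h, hf.2]⟩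

end SequenceGerms

section Derivations

open Filter Topology

variable {L : Type*} [Field L] [Algebra ℝ L] {π : (ℕ → ℝ) →ₐ[ℝ] L}
variable {E E' : Type*} [NormedAddCommGroup E] [NormedSpace ℝ E]
  [NormedAddCommGroup E'] [NormedSpace ℝ E']

/-- Every transcendental element of the field generated by the generic values of analytic
functions along `x` is moved by a derivation which on these values is differentiation in suitable
directions. -/
def HasDerivationsAlong (π : (ℕ → ℝ) →ₐ[ℝ] L) (x : ℕ → E) : Prop :=
  ∀ r ∈ germField π x, Transcendental ℝ r → ∃ (D : Derivation ℝ L L) (w : ℕ → E),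
    (∀ f, AnalyticAt ℝ f 0 → D (valueAlong π x f) = derivAlong π x w f) ∧
    (∀ f, AnalyticAt ℝ f 0 → D (valueAlong π x f) ∈ germField π x) ∧ D r ≠ 0

theorem HasDerivationsAlong.of_equiv {x : ℕ → E} (e : E ≃L[ℝ] E')
    (h : HasDerivationsAlong π fun n => e (x n)) : HasDerivationsAlong π x := by
  have hval (f : E → ℝ) :
      valueAlong π x f = valueAlong π (fun n => e (x n)) (f ∘ e.symm) := by
    simp [valueAlong_apply]
  have hana {f : E → ℝ} (hf : AnalyticAt ℝ f 0) : AnalyticAt ℝ (f ∘ e.symm) 0 :=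
    AnalyticAt.comp (by simpa using hf) (e.symm.toContinuousLinearMap.analyticAt 0)
  have hana' {f : E' → ℝ} (hf : AnalyticAt ℝ f 0) : AnalyticAt ℝ (f ∘ e) 0 :=
    AnalyticAt.comp (by simpa using hf) (e.toContinuousLinearMap.analyticAt 0)
  intro r hr htr
  obtain ⟨D, w, hw, hD, hDr⟩ := h r
    (germField_le (fun f hf => hval f ▸ valueAlong_mem_germField (hana hf)) hr) htr
  refine ⟨D, fun n => e.symm (w n), fun f hf => ?_, fun f hf => ?_, hDr⟩
  · rw [hval, hw _ (hana hf)]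
    simp [derivAlong, e.symm.comp_right_fderiv]
  · rw [hval]
    refine germField_le (π := π) (x := fun n => e (x n)) (K := germField π x) (fun f hf => ?_)
      (hD _ (hana hf))
    exact valueAlong_mem_germField (π := π) (x := x) (hana' hf)

/-- A quotient of analytic functions with vanishing derivative is constant. -/
theorem AnalyticAt.exists_eventuallyEq_const_mul {a b : E → ℝ} (ha : AnalyticAt ℝ a 0)
    (hb : AnalyticAt ℝ b 0) (hb0 : ¬ b =ᶠ[𝓝 0] 0)
    (hab : ∀ᶠ z in 𝓝 0, b z • fderiv ℝ a z = a z • fderiv ℝ b z) :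
    ∃ c : ℝ, a =ᶠ[𝓝 0] fun z => c * b z := by
  obtain ⟨R, hR, hball⟩ := Metric.eventually_nhds_iff_ball.1
    (ha.eventually_analyticAt.and (hb.eventually_analyticAt.and hab))
  obtain ⟨z₀, hz₀, hbz₀⟩ : ∃ z ∈ Metric.ball (0 : E) R, b z ≠ 0 := by
    by_contra! h
    exact hb0 (Filter.eventually_of_mem (Metric.ball_mem_nhds 0 hR) h)
  refine ⟨a z₀ / b z₀, ?_⟩
  have hana : AnalyticOnNhd ℝ (fun z => a z - a z₀ / b z₀ * b z) (Metric.ball 0 R) :=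
    fun z hz => (hball z hz).1.sub (analyticAt_const.mul (hball z hz).2.1)
  have hloc : (fun z => a z - a z₀ / b z₀ * b z) =ᶠ[𝓝 z₀] 0 := by
    obtain ⟨R', hR', hball'⟩ := Metric.eventually_nhds_iff_ball.1
      ((Metric.isOpen_ball.eventually_mem hz₀).and
        ((hball z₀ hz₀).2.1.continuousAt.eventually_ne hbz₀))
    have hderiv (z : E) (hz : z ∈ Metric.ball z₀ R') :
        HasFDerivAt (fun z => a z / b z) (0 : E →L[ℝ] ℝ) z := by
      obtain ⟨hzR, hbz⟩ := hball' z hz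
      obtain ⟨ha', hb', hab'⟩ := hball z hzR
      have := ha'.differentiableAt.hasFDerivAt.fun_mul
        ((hasDerivAt_inv hbz).comp_hasFDerivAt z hb'.differentiableAt.hasFDerivAt)
      refine (this.congr_fderiv ?_).congr_of_eventuallyEq
        (Eventually.of_forall fun y => div_eq_mul_inv _ _)
      ext v
      have hv := DFunLike.congr_fun hab' v
      simp only [smul_apply, smul_eq_mul, add_apply, zero_apply, Function.comp_apply] at hv ⊢
      field_simp
      linear_combination hv
    refine Filter.eventually_of_mem (Metric.ball_mem_nhds z₀ hR') fun z hz => ?_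
    have hconst : a z / b z = a z₀ / b z₀ :=
      Metric.isOpen_ball.is_const_of_fderiv_eq_zero (𝕜 := ℝ) (f := fun z => a z / b z)
        (convex_ball z₀ R').isPreconnected
        (fun z hz => (hderiv z hz).differentiableAt.differentiableWithinAt)
        (fun z hz => (hderiv z hz).fderiv) hz (Metric.mem_ball_self hR')
    have hbz := (hball' z hz).2
    simp only [Pi.zero_apply]
    rw [← hconst, div_mul_cancel₀ _ hbz, sub_self]
  have hzero := hana.eqOn_zero_of_preconnected_of_eventuallyEq_zero
    (convex_ball 0 R).isPreconnected hz₀ hloc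
  exact Filter.eventually_of_mem (Metric.ball_mem_nhds 0 hR) fun z hz => sub_eq_zero.1 (hzero hz)

/-- An analytic function vanishing near the origin on every line vanishes near the origin. -/
theorem AnalyticAt.eventuallyEq_zero_of_lines {g : E → ℝ} (hg : AnalyticAt ℝ g 0)
    (h : ∀ v : E, ∀ᶠ t in 𝓝 (0 : ℝ), g (t • v) = 0) : g =ᶠ[𝓝 0] 0 := by
  obtain ⟨R, hR, hball⟩ := Metric.eventually_nhds_iff_ball.1 hg.eventually_analyticAt
  refine Filter.eventually_of_mem (Metric.ball_mem_nhds 0 hR) fun v hv => ?_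
  let l : ℝ →L[ℝ] E := ContinuousLinearMap.toSpanSingleton ℝ v
  have hana : AnalyticOnNhd ℝ (g ∘ l) (l ⁻¹' Metric.ball 0 R) :=
    fun t ht => (hball (l t) ht).comp (l.analyticAt t)
  have := hana.eqOn_zero_of_preconnected_of_eventuallyEq_zero
    ((convex_ball (0 : E) R).linear_preimage l.toLinearMap).isPreconnected
    (z₀ := 0) (by simpa using hR) (h v)
  simpa [l] using this (x := 1) (by simpa [l] using hv)

theorem hasDerivationsAlong_of_generic [FiniteDimensional ℝ E] {x : ℕ → E}
    (h0 : ∀ f : ℕ → ℝ, f =ᶠ[atTop] 0 → π f = 0) (hx : Tendsto x atTop (𝓝 0))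
    (hgen : ∀ f : E → ℝ, AnalyticAt ℝ f 0 → valueAlong π x f = 0 → f =ᶠ[𝓝 0] 0) :
    HasDerivationsAlong π x := by
  intro r hr htr
  obtain ⟨a, b, ha, hb, rfl⟩ := exists_eq_div_of_mem_germField hr
  have hfd {f : E → ℝ} (hf : AnalyticAt ℝ f 0) (v : E) :
      AnalyticAt ℝ (fun z => fderiv ℝ f z v) 0 :=
    ((ContinuousLinearMap.apply ℝ ℝ v).analyticAt _).fun_comp hf.fderiv
  have hDv (v : E) : ∃ D : Derivation ℝ L L, ∀ f, AnalyticAt ℝ f 0 →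
      D (valueAlong π x f) = derivAlong π x (fun _ => v) f := by
    let h : analyticSubalgebra E →ₐ[ℝ] TrivSqZeroExt L L :=
      { toFun := fun f => TrivSqZeroExt.inl (valueAlong π x f) +
          TrivSqZeroExt.inr (derivAlong π x (fun _ => v) f)
        map_one' := by
          have := derivAlong_algebraMap (x := x) (w := fun _ => v) h0 1
          rw [map_one] at this
          ext <;> simp [this]
        map_zero' := by
          have := derivAlong_algebraMap (x := x) (w := fun _ => v) h0 0
          rw [map_zero] at this
          ext <;> simp [this]
        map_mul' := fun f g => by
          ext
          · simp
          · simp [derivAlong_mul h0 hx f.2 g.2, mul_comm]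
        map_add' := fun f g => by
          ext
          · simp
          · simp [derivAlong_add h0 hx f.2 g.2]
        commutes' := fun c => by
          have := derivAlong_algebraMap (x := x) (w := fun _ => v) h0 c
          ext
          · simp [TrivSqZeroExt.algebraMap_eq_inl']
          · simp [this, TrivSqZeroExt.algebraMap_eq_inl'] }
    obtain ⟨D, hD⟩ := exists_derivation_of_algHom h (by
      intro f hf
      have hf' : valueAlong π x f = 0 := by simpa [h] using hf
      have h1 := hgen _ f.2 hf'
      have h2 : derivAlong π x (fun _ => v) f = 0 := by
        rw [derivAlong_congr h0 hx h1]
        simpa using derivAlong_algebraMap (x := x) (w := fun _ => v) h0 0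
      simpa [h] using h2)
    refine ⟨D, fun f hf => ?_⟩
    simpa [h] using hD ⟨f, hf⟩
  by_contra hcon
  push Not at hcon
  have hb0 : valueAlong π x b ≠ 0 := by
    intro hb0
    rw [hb0, div_zero] at htr
    exact htr isAlgebraic_zero
  have hz (v : E) : ∀ᶠ z in 𝓝 0, b z * fderiv ℝ a z v = a z * fderiv ℝ b z v := by
    obtain ⟨D, hD⟩ := hDv v
    have hD0 := hcon D (fun _ => v) hD (fun f hf => by
      rw [hD f hf]
      exact valueAlong_mem_germField (hfd hf v))
    rw [D.leibniz_div, smul_eq_zero] at hD0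
    have h1 := hD0.resolve_left (pow_ne_zero _ (inv_ne_zero hb0))
    rw [hD a ha, hD b hb] at h1
    have h2 := hgen (fun z => b z * fderiv ℝ a z v - a z * fderiv ℝ b z v)
      ((hb.mul (hfd ha v)).sub (ha.mul (hfd hb v))) (by
        rw [← h1]
        exact (map_sub (valueAlong π x) (b * fun z => fderiv ℝ a z v)
          (a * fun z => fderiv ℝ b z v)).trans (by rw [map_mul, map_mul]; rfl))
    exact h2.mono fun z hz => sub_eq_zero.1 hz
  obtain ⟨c, hc⟩ := ha.exists_eventuallyEq_const_mul hb
    (fun h => hb0 (by rw [valueAlong_congr h0 hx h, map_zero])) (by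
      have bE := Module.finBasis ℝ E
      filter_upwards [eventually_all.2 fun i => hz (bE i)] with z hz
      exact ContinuousLinearMap.coe_injective (bE.ext fun i => hz i))
  apply htr
  have hac : valueAlong π x a = algebraMap ℝ L c * valueAlong π x b := by
    rw [valueAlong_congr h0 hx hc, ← AlgHom.commutes (valueAlong π x), ← map_mul]
    rfl
  rw [hac, mul_div_cancel_right₀ _ hb0]
  exact isAlgebraic_algebraMap c

end Derivations

section Induction

open Filter Topology

variable {L : Type*} [Field L] [Algebra ℝ L] {π : (ℕ → ℝ) →ₐ[ℝ] L}

theorem hasDerivationsAlong_of_fst {E : Type*} [NormedAddCommGroup E] [NormedSpace ℝ E]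
    [FiniteDimensional ℝ E] {x : ℕ → E × ℝ} (hπ : Function.Surjective π)
    (h0 : ∀ f : ℕ → ℝ, f =ᶠ[atTop] 0 → π f = 0) (hx : Tendsto x atTop (𝓝 0))
    {g : E × ℝ → ℝ} (hg : AnalyticAt ℝ g 0) (hg0 : ¬ ∀ᶠ t in 𝓝 (0 : ℝ), g (0, t) = 0)
    (hxg : valueAlong π x g = 0) (h : HasDerivationsAlong π fun n => (x n).1) :
    HasDerivationsAlong π x := by
  obtain ⟨d, hdiv, q₀, r₀, hq₀, hr₀, hq₀0, hprep⟩ := hg.exists_weierstrass hg0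
  set K := germField π fun n => (x n).1 with hK
  set s := valueAlong π x Prod.snd with hs
  have hsnd : AnalyticAt ℝ (Prod.snd : E × ℝ → ℝ) 0 := analyticAt_snd
  have hfst {f : E → ℝ} (hf : AnalyticAt ℝ f 0) : AnalyticAt ℝ (f ∘ Prod.fst : E × ℝ → ℝ) 0 :=
    AnalyticAt.comp (x := (0 : E × ℝ)) hf analyticAt_fst
  have hvfst (f : E → ℝ) :
      valueAlong π x (f ∘ Prod.fst) = valueAlong π (fun n => (x n).1) f := rfl
  have hKle : K ≤ germField π x :=
    germField_le fun f hf => hvfst f ▸ valueAlong_mem_germField (hfst hf)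
  have hsmem : s ∈ germField π x := valueAlong_mem_germField hsnd
  have hpoly (r : ℕ → E → ℝ) : (fun z : E × ℝ => ∑ j ∈ Finset.range d, r j z.1 * z.2 ^ j) =
      ∑ j ∈ Finset.range d, (r j ∘ Prod.fst) * Prod.snd ^ j := by
    ext z
    simp
  have hval {f q : E × ℝ → ℝ} {r : ℕ → E → ℝ}
      (hfq : ∀ᶠ z in 𝓝 0, f z = g z * q z + ∑ j ∈ Finset.range d, r j z.1 * z.2 ^ j) :
      valueAlong π x f =
        ∑ j ∈ Finset.range d, valueAlong π (fun n => (x n).1) (r j) * s ^ j := by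
    have : f =ᶠ[𝓝 0] g * q + ∑ j ∈ Finset.range d, (r j ∘ Prod.fst) * Prod.snd ^ j := by
      rw [← hpoly]
      exact hfq
    rw [valueAlong_congr h0 hx this, map_add, map_mul, hxg, zero_mul, zero_add, map_sum]
    simp_rw [map_mul, map_pow, hvfst]
    rfl
  have hsint : IsIntegral K s := by
    let P : Polynomial K := ∑ j ∈ Finset.range d, Polynomial.C
      ⟨valueAlong π (fun n => (x n).1) (r₀ j), valueAlong_mem_germField (hr₀ j)⟩ *
        Polynomial.X ^ j
    have hPdeg : P.degree < d := by
      refine Polynomial.mem_degreeLT.1 (sum_mem fun j hj => Polynomial.mem_degreeLT.2 ?_)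
      exact (Polynomial.degree_C_mul_X_pow_le _ _).trans_lt
        (WithBot.coe_lt_coe.2 (Finset.mem_range.1 hj))
    refine ⟨Polynomial.X ^ d - P, Polynomial.monic_X_pow_sub hPdeg, ?_⟩
    have := hval (f := Prod.snd ^ d) hprep
    rw [map_pow, ← hs] at this
    rw [← Polynomial.aeval_def, map_sub, map_pow, Polynomial.aeval_X, this, map_sum, sub_eq_zero]
    refine Finset.sum_congr rfl fun j _ => ?_
    rw [map_mul, Polynomial.aeval_C, map_pow, Polynomial.aeval_X]
    rfl
  have halg : germField π x ≤ (algebraicClosure K L).restrictScalars ℝ := by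
    refine germField_le fun f hf => ?_
    obtain ⟨q, r, hq, hr, hfq⟩ := hdiv f hf
    rw [hval hfq]
    refine sum_mem fun j _ => mul_mem ?_ (pow_mem ?_ j)
    · exact (algebraicClosure K L).algebraMap_mem ⟨_, valueAlong_mem_germField (hr j)⟩
    · exact mem_algebraicClosure_iff.2 hsint.isAlgebraic
  intro y hy hty
  have hyint : IsIntegral K y := (mem_algebraicClosure_iff.1 (halg hy)).isIntegral
  obtain ⟨j, hj⟩ := exists_transcendental_coeff_minpoly hyint hty
  obtain ⟨D, w, hw, hD, hDj⟩ := h _ ((minpoly K y).coeff j).2 hj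
  have hDK := Derivation.apply_mem_germField hD
  have hDs : D s ∈ germField π x :=
    Derivation.apply_mem_adjoin_of_isIntegral hDK hsint hKle hsmem
  obtain ⟨u, hu⟩ := hπ (D s)
  let T := differentiatedSubalgebra h0 hx D fun n => (w n, u n)
  have hTfst {f : E → ℝ} (hf : AnalyticAt ℝ f 0) : f ∘ Prod.fst ∈ T := by
    refine ⟨hfst hf, ?_⟩
    rw [hvfst, hw f hf]
    have hx1 : Tendsto (fun n => (x n).1) atTop (𝓝 0) :=
      (continuous_fst.tendsto (0 : E × ℝ)).comp hx
    refine AlgHom.congr_of_eventuallyEq h0 ?_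
    filter_upwards [hx1.eventually hf.eventually_analyticAt] with n hn
    rw [fderiv_comp (x n) hn.differentiableAt differentiableAt_fst, fderiv_fst]
    rfl
  have hTsnd : Prod.snd ∈ T := by
    refine ⟨hsnd, ?_⟩
    rw [← hs, ← hu]
    simp [derivAlong, fderiv_snd]
  have hTpoly {r : ℕ → E → ℝ} (hr : ∀ j, AnalyticAt ℝ (r j) 0) :
      (fun z : E × ℝ => ∑ j ∈ Finset.range d, r j z.1 * z.2 ^ j) ∈ T := by
    rw [hpoly]
    exact sum_mem fun j _ => mul_mem (hTfst (hr j)) (pow_mem hTsnd j)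
  have hTg : g ∈ T := by
    refine ⟨hg, ?_⟩
    have hmem : g * q₀ ∈ T := by
      refine mem_differentiatedSubalgebra_congr h0 hx ?_
        (sub_mem (pow_mem hTsnd d) (hTpoly hr₀))
      exact hprep.mono fun z hz => by
        simp only [Pi.sub_apply, Pi.pow_apply, Pi.mul_apply]
        linear_combination hz
    have h1 := hmem.2
    rw [derivAlong_mul h0 hx hg hq₀, map_mul, hxg, zero_mul, map_zero, zero_mul, zero_add] at h1
    have h2 := (mul_eq_zero.1 h1.symm).resolve_left
      (valueAlong_ne_zero h0 hx hq₀.continuousAt hq₀0)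
    rw [hxg, map_zero, h2]
  refine ⟨D, fun n => (w n, u n), fun f hf => ?_, fun f hf => ?_,
    Derivation.apply_ne_zero_of_isIntegral hDK hyint hDj⟩
  · obtain ⟨q, r, hq, hr, hfq⟩ := hdiv f hf
    have hgq : g * q ∈ T := by
      refine ⟨hg.mul hq, ?_⟩
      rw [derivAlong_mul h0 hx hg hq, map_mul, hxg, ← hTg.2, hxg]
      simp
    exact (mem_differentiatedSubalgebra_congr h0 hx (EventuallyEq.symm hfq)
      (add_mem hgq (hTpoly hr))).2
  · obtain ⟨q, r, hq, hr, hfq⟩ := hdiv f hf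
    rw [hval hfq, map_sum]
    refine sum_mem fun j _ => ?_
    have hrj : valueAlong π (fun n => (x n).1) (r j) ∈ K := valueAlong_mem_germField (hr j)
    rw [D.leibniz, D.leibniz_pow]
    refine add_mem (mul_mem (hKle hrj) (nsmul_mem (mul_mem (pow_mem hsmem _) hDs) _))
      (mul_mem (pow_mem hsmem j) (hKle (hDK _ hrj)))

theorem hasDerivationsAlong (hπ : Function.Surjective π)
    (h0 : ∀ f : ℕ → ℝ, f =ᶠ[atTop] 0 → π f = 0) {E : Type*} [NormedAddCommGroup E]
    [NormedSpace ℝ E] [FiniteDimensional ℝ E] {x : ℕ → E} (hx : Tendsto x atTop (𝓝 0)) :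
    HasDerivationsAlong π x := by
  induction hd : Module.finrank ℝ E using Nat.strong_induction_on generalizing E with
  | _ d ih =>
    by_cases hgen : ∀ f : E → ℝ, AnalyticAt ℝ f 0 → valueAlong π x f = 0 → f =ᶠ[𝓝 0] 0
    · exact hasDerivationsAlong_of_generic h0 hx hgen
    push Not at hgen
    obtain ⟨g, hg, hxg, hg0⟩ := hgen
    obtain ⟨v, hv⟩ : ∃ v : E, ¬ ∀ᶠ t in 𝓝 (0 : ℝ), g (t • v) = 0 := by
      by_contra! h
      exact hg0 (hg.eventuallyEq_zero_of_lines h)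
    have hv0 : v ≠ 0 := by
      rintro rfl
      have hg00 : g 0 ≠ 0 := fun h => hv (Eventually.of_forall fun t => by simpa using h)
      exact valueAlong_ne_zero h0 hx hg.continuousAt hg00 hxg
    obtain ⟨φ, hφ⟩ := SeparatingDual.exists_eq_one (R := ℝ) hv0
    let e' : E ≃L[ℝ] ℝ × φ.ker := ContinuousLinearEquiv.equivOfRightInverse φ
      (ContinuousLinearMap.toSpanSingleton ℝ v) fun t => by simp [hφ]
    let e : E ≃L[ℝ] φ.ker × ℝ := e'.trans (ContinuousLinearEquiv.prodComm ℝ ℝ φ.ker)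
    have hev (t : ℝ) : e.symm (0, t) = t • v := by
      change e'.symm (t, 0) = _
      simp [e']
    have hex : Tendsto (fun n => e (x n)) atTop (𝓝 0) := by
      have := (e.continuous.tendsto 0).comp hx
      rwa [map_zero] at this
    refine HasDerivationsAlong.of_equiv e ?_
    refine hasDerivationsAlong_of_fst hπ h0 hex (g := g ∘ e.symm)
      (AnalyticAt.comp (by simpa using hg) (e.symm.toContinuousLinearMap.analyticAt 0))
      (by simpa only [Function.comp_apply, hev] using hv)
      (by simpa [valueAlong_apply] using hxg) ?_
    refine ih (Module.finrank ℝ φ.ker) ?_ ((continuous_fst.tendsto 0).comp hex) rfl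
    have := e.toLinearEquiv.finrank_eq
    rw [Module.finrank_prod, Module.finrank_self] at this
    omega

end Induction

section MilnorSets

open Filter Topology

/-- The field of generic values of real sequences. -/
theorem exists_surjective_algHom_of_sequences :
    ∃ (L : Type) (_ : Field L) (_ : Algebra ℝ L) (π : (ℕ → ℝ) →ₐ[ℝ] L),
      Function.Surjective π ∧ ∀ f : ℕ → ℝ, f =ᶠ[atTop] 0 → π f = 0 := by
  let I : Ideal (ℕ → ℝ) :=
    { carrier := {f | f =ᶠ[atTop] 0}
      add_mem' := fun {f g} hf hg => by simpa using hf.add hg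
      zero_mem' := EventuallyEq.rfl
      smul_mem' := fun c f hf => by simpa using (EventuallyEq.refl atTop c).mul hf }
  have hI : I ≠ ⊤ := by
    rw [Ideal.ne_top_iff_one]
    intro h
    have h' : (1 : ℕ → ℝ) =ᶠ[atTop] 0 := h
    obtain ⟨n, hn⟩ := h'.exists
    exact one_ne_zero hn
  obtain ⟨M, hM, hIM⟩ := Ideal.exists_le_maximal I hI
  exact ⟨(ℕ → ℝ) ⧸ M, Ideal.Quotient.field M, inferInstance, Ideal.Quotient.mkₐ ℝ M,
    Ideal.Quotient.mkₐ_surjective ℝ M, fun f hf => Ideal.Quotient.eq_zero_iff_mem.2 (hIM hf)⟩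

theorem AlgHom.transcendental_of_tendsto_zero {L : Type*} [Field L] [Algebra ℝ L]
    {π : (ℕ → ℝ) →ₐ[ℝ] L} (h0 : ∀ f : ℕ → ℝ, f =ᶠ[atTop] 0 → π f = 0) {a : ℕ → ℝ}
    (ha : Tendsto a atTop (𝓝 0)) (hane : ∀ n, a n ≠ 0) : Transcendental ℝ (π a) := by
  rintro ⟨P, hP, hPa⟩
  rw [Polynomial.aeval_algHom_apply] at hPa
  refine AlgHom.ne_zero_of_eventually_ne h0 ?_ hPa
  have hfin : ({y | P.IsRoot y} \ {0}).Finite :=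
    (P.finite_setOfPred_isRoot hP).subset Set.sdiff_subset
  have hev : ∀ᶠ y in 𝓝 (0 : ℝ), y ∉ {y | P.IsRoot y} \ {0} :=
    hfin.isClosed.isOpen_compl.mem_nhds (by simp)
  filter_upwards [ha.eventually hev] with n hn h
  refine hn ⟨?_, hane n⟩
  have := Polynomial.aeval_algHom_apply (Pi.evalAlgHom ℝ (fun _ : ℕ => ℝ) n) a P
  simp only [Pi.evalAlgHom_apply, h] at this
  exact this

variable {E Y : Type*} [NormedAddCommGroup E] [InnerProductSpace ℝ E]
  [NormedAddCommGroup Y] [NormedSpace ℝ Y]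

theorem differentiableAt_norm_sq (y : E) : DifferentiableAt ℝ (fun z : E => ‖z‖ ^ 2) y :=
  differentiableAt_id.norm_sq ℝ

theorem mem_milnorSet_iff {Φ : E → Y} {y : E} (hΦ : DifferentiableAt ℝ Φ y) :
    y ∈ MilnorSet Φ ↔ ¬ Function.Surjective
      ((fderiv ℝ Φ y).prod (fderiv ℝ (fun z : E => ‖z‖ ^ 2) y)) := by
  rw [← hΦ.fderiv_prodMk (differentiableAt_norm_sq y)]
  rfl

theorem exists_fderiv_norm_sq_eq_comp {Φ : E → Y} {y : E} (hΦ : DifferentiableAt ℝ Φ y)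
    (hM : y ∈ MilnorSet Φ) (hS : y ∉ SingSet Φ) :
    ∃ l : Y →ₗ[ℝ] ℝ, ∀ v, fderiv ℝ (fun z : E => ‖z‖ ^ 2) y v = l (fderiv ℝ Φ y v) := by
  have hsurj : Function.Surjective (fderiv ℝ Φ y) := not_not.1 hS
  rw [mem_milnorSet_iff hΦ] at hM
  have hker (v : E) (hv : fderiv ℝ Φ y v = 0) : fderiv ℝ (fun z : E => ‖z‖ ^ 2) y v = 0 := by
    by_contra hne
    apply hM
    rintro ⟨a, c⟩
    obtain ⟨u, hu⟩ := hsurj a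
    refine ⟨u + ((c - fderiv ℝ (fun z : E => ‖z‖ ^ 2) y u) /
      fderiv ℝ (fun z : E => ‖z‖ ^ 2) y v) • v, Prod.ext ?_ ?_⟩
    · simp [hu, hv]
    · change fderiv ℝ (fun z : E => ‖z‖ ^ 2) y _ = c
      rw [map_add, map_smul, smul_eq_mul, div_mul_cancel₀ _ hne, add_sub_cancel]
  obtain ⟨g, hg⟩ := (fderiv ℝ Φ y).toLinearMap.exists_rightInverse_of_surjective
    (LinearMap.range_eq_top.2 hsurj)
  refine ⟨(fderiv ℝ (fun z : E => ‖z‖ ^ 2) y).toLinearMap ∘ₗ g, fun v => ?_⟩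
  have hgv : fderiv ℝ Φ y (g (fderiv ℝ Φ y v)) = fderiv ℝ Φ y v :=
    LinearMap.congr_fun hg (fderiv ℝ Φ y v)
  have := hker (v - g (fderiv ℝ Φ y v)) (by rw [map_sub, hgv, sub_self])
  rw [map_sub, sub_eq_zero] at this
  exact this

/-- Near the origin, the regular part of the zero fiber of an analytic germ is transverse to the
spheres. -/
theorem AnalyticAt.exists_ball_milnorSet [FiniteDimensional ℝ E] [FiniteDimensional ℝ Y]
    {G : E → Y} (hG : AnalyticAt ℝ G 0) :
    ∃ ε > 0, ∀ y ∈ Metric.ball (0 : E) ε,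
      G y = 0 → y ∈ MilnorSet G → y ∉ SingSet G → y = 0 := by
  by_contra! hcon
  choose! y hyball hGy hyM hyS hy0 using fun n : ℕ =>
    hcon (1 / ((n : ℝ) + 1)) Nat.one_div_pos_of_nat
  have hy : Tendsto y atTop (𝓝 0) := by
    rw [tendsto_zero_iff_norm_tendsto_zero]
    exact squeeze_zero (fun n => norm_nonneg _) (fun n => (mem_ball_zero_iff.1 (hyball n)).le)
      tendsto_one_div_add_atTop_nhds_zero_nat
  obtain ⟨L, _, _, π, hπ, h0⟩ := exists_surjective_algHom_of_sequences
  let ρ : E → ℝ := fun z => ‖z‖ ^ 2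
  have hρ : AnalyticAt ℝ ρ 0 := by
    have : AnalyticAt ℝ (fun z : E => inner ℝ z z) 0 :=
      ((innerSL ℝ (E := E)).analyticAt_bilinear (0, 0)).fun_comp
        (f := fun z : E => (z, z)) (analyticAt_id.prod analyticAt_id)
    simpa only [real_inner_self_eq_norm_sq] using this
  have htr : Transcendental ℝ (valueAlong π y ρ) := by
    refine AlgHom.transcendental_of_tendsto_zero h0 ?_ fun n => ?_
    · have := hρ.continuousAt.tendsto.comp hy
      rwa [show ρ 0 = 0 by simp [ρ]] at this
    · simpa [ρ] using hy0 n
  obtain ⟨D, w, hw, -, hDρ⟩ :=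
    hasDerivationsAlong hπ h0 hy _ (valueAlong_mem_germField hρ) htr
  apply hDρ
  rw [hw ρ hρ]
  have hdiff : ∀ᶠ n in atTop, DifferentiableAt ℝ G (y n) :=
    (hy.eventually hG.eventually_analyticAt).mono fun n hn => hn.differentiableAt
  let b := Module.finBasis ℝ Y
  let coord i : Y →L[ℝ] ℝ := LinearMap.toContinuousLinearMap (b.coord i)
  have hcoord i : derivAlong π y w (coord i ∘ G) = 0 := by
    rw [← hw _ (((coord i).analyticAt _).comp hG)]
    have : valueAlong π y (coord i ∘ G) = 0 := by
      rw [valueAlong_apply, ← map_zero π]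
      congr 1
      ext n
      simp [hGy]
    rw [this, map_zero]
  have hl (n : ℕ) : ∃ l : Y →ₗ[ℝ] ℝ, DifferentiableAt ℝ G (y n) →
      ∀ v, fderiv ℝ ρ (y n) v = l (fderiv ℝ G (y n) v) := by
    by_cases h : DifferentiableAt ℝ G (y n)
    · obtain ⟨l, hl⟩ := exists_fderiv_norm_sq_eq_comp h (hyM n) (hyS n)
      exact ⟨l, fun _ => hl⟩
    · exact ⟨0, fun h' => absurd h' h⟩
  choose l hl using hl
  have hsum : derivAlong π y w ρ =
      ∑ i, π (fun n => l n (b i)) * derivAlong π y w (coord i ∘ G) := by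
    simp only [derivAlong]
    simp_rw [← map_mul]
    rw [← map_sum]
    refine AlgHom.congr_of_eventuallyEq h0 ?_
    filter_upwards [hdiff] with n hn
    rw [hl n hn, Finset.sum_apply]
    conv_lhs => rw [← b.sum_repr (fderiv ℝ G (y n) (w n)), map_sum]
    refine Finset.sum_congr rfl fun i _ => ?_
    rw [Pi.mul_apply, fderiv_comp (y n) (coord i).differentiableAt hn,
      ContinuousLinearMap.fderiv, map_smul, smul_eq_mul, mul_comm]
    rfl
  rw [hsum]
  simp [hcoord]

end MilnorSets

section Composition

variable {E X Y : Type*} [NormedAddCommGroup E] [InnerProductSpace ℝ E]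
  [NormedAddCommGroup X] [NormedSpace ℝ X] [NormedAddCommGroup Y] [NormedSpace ℝ Y]

theorem notMem_singSet_of_comp {F : E → X} {G : X → Y} {x : E} (hF : DifferentiableAt ℝ F x)
    (hG : DifferentiableAt ℝ G (F x)) (hx : x ∉ SingSet (G ∘ F)) : F x ∉ SingSet G := by
  have h : Function.Surjective (fderiv ℝ (G ∘ F) x) := not_not.1 hx
  rw [fderiv_comp x hG hF] at h
  exact not_not.2 (Function.Surjective.of_comp h)

theorem mem_milnorSet_of_comp {F : E → X} {G : X → Y} {x : E} (hF : DifferentiableAt ℝ F x)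
    (hG : DifferentiableAt ℝ G (F x)) (hx : x ∈ MilnorSet (G ∘ F)) (hS : F x ∉ SingSet G) :
    x ∈ MilnorSet F := by
  rw [mem_milnorSet_iff (hG.comp x hF)] at hx
  rw [mem_milnorSet_iff hF]
  refine fun h => hx ?_
  rw [fderiv_comp x hG hF]
  rintro ⟨a, c⟩
  obtain ⟨u, hu⟩ := not_not.1 hS a
  obtain ⟨v, hv⟩ := h (u, c)
  rw [ContinuousLinearMap.prod_apply, Prod.mk.injEq] at hv
  exact ⟨v, Prod.ext ((congrArg _ hv.1).trans hu) hv.2⟩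

end Composition

/-- Let `F : (ℝ^m,0) → (ℝ^p,0)` and `G : (ℝ^p,0) → (ℝ^k,0)` (`m ≥ p ≥ k ≥ 2`) be analytic
map germs with isolated critical value `0`, with `F` satisfying the Milnor condition (b),
and `H = G ∘ F`. If `F(M(H)) ⊆ M(G)` as set germs at `0` and `G` satisfies the Milnor
condition (b), then `closure (F(M(H) ∖ Sing H)) ∩ Sing G ⊆ {0}` holds near the origin, and
hence `H` satisfies the Milnor condition (b). -/
theorem milnor_condition_b_composition {m p k : ℕ}
    (hmp : p ≤ m) (hpk : k ≤ p) (hk : 2 ≤ k)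
    (F : EuclideanSpace ℝ (Fin m) → EuclideanSpace ℝ (Fin p))
    (G : EuclideanSpace ℝ (Fin p) → EuclideanSpace ℝ (Fin k))
    (hF : AnalyticOnNhd ℝ F Set.univ) (hG : AnalyticOnNhd ℝ G Set.univ)
    (hF0 : F 0 = 0) (hG0 : G 0 = 0)
    (hFic : SingSet F ⊆ F ⁻¹' {0}) (hGic : SingSet G ⊆ G ⁻¹' {0})
    (hFb : MilnorCondB F) (hGb : MilnorCondB G)
    (hincl : ∃ ε > (0 : ℝ),
      F '' (MilnorSet (G ∘ F) ∩ Metric.ball 0 ε) ⊆ MilnorSet G) :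
    (∃ ε > (0 : ℝ),
      closure (F '' ((MilnorSet (G ∘ F) \ SingSet (G ∘ F)) ∩ Metric.ball 0 ε)) ∩
          SingSet G ⊆ {0}) ∧
    MilnorCondB (G ∘ F) := by
  have hFd x : DifferentiableAt ℝ F x := (hF x (Set.mem_univ x)).differentiableAt
  have hGd y : DifferentiableAt ℝ G y := (hG y (Set.mem_univ y)).differentiableAt
  obtain ⟨εi, hεi, hincl⟩ := hincl
  obtain ⟨εF, hεF, hFb⟩ := hFb
  obtain ⟨εG, hεG, hGb⟩ := hGb
  obtain ⟨ε₀, hε₀, hreg⟩ := (hG 0 (Set.mem_univ 0)).exists_ball_milnorSet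
  obtain ⟨δ, hδ, hδF⟩ := Metric.continuousAt_iff.1 (hFd 0).continuousAt (min ε₀ εG)
    (lt_min hε₀ hεG)
  rw [hF0] at hδF
  refine ⟨⟨min εi δ, lt_min hεi hδ, ?_⟩, min (min εi δ) εF, lt_min (lt_min hεi hδ) hεF, ?_⟩
  · rintro y ⟨hy, hyS⟩
    have hsub : F '' ((MilnorSet (G ∘ F) \ SingSet (G ∘ F)) ∩ Metric.ball 0 (min εi δ)) ⊆
        {0} ∪ (MilnorSet G \ G ⁻¹' {0}) ∩ Metric.ball 0 εG := by
      rintro _ ⟨x, ⟨⟨hxM, hxS⟩, hx⟩, rfl⟩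
      have hFM := hincl ⟨x, ⟨hxM, Metric.ball_subset_ball (min_le_left _ _) hx⟩, rfl⟩
      have hFx := hδF (Metric.ball_subset_ball (min_le_right _ _) hx)
      by_cases hGF : G (F x) = 0
      · exact Or.inl (hreg _ (hFx.trans_le (min_le_left _ _)) hGF hFM
          (notMem_singSet_of_comp (hFd x) (hGd _) hxS))
      · exact Or.inr ⟨⟨hFM, hGF⟩, hFx.trans_le (min_le_right _ _)⟩
    have hy' := closure_mono hsub hy
    rw [closure_union, closure_singleton] at hy'
    exact hy'.elim id fun h => hGb ⟨h, hGic hyS⟩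
  · rintro x ⟨hx, hHx⟩
    have hmaps : Set.MapsTo F
        ((MilnorSet (G ∘ F) \ (G ∘ F) ⁻¹' {0}) ∩ Metric.ball 0 (min (min εi δ) εF))
        ((MilnorSet G \ G ⁻¹' {0}) ∩ Metric.ball 0 εG) := by
      rintro z ⟨⟨hzM, hzV⟩, hz⟩
      have hz' := Metric.ball_subset_ball (min_le_left _ _) hz
      exact ⟨⟨hincl ⟨z, ⟨hzM, Metric.ball_subset_ball (min_le_left _ _) hz'⟩, rfl⟩, hzV⟩,
        (hδF (Metric.ball_subset_ball (min_le_right _ _) hz')).trans_le (min_le_right _ _)⟩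
    refine hFb ⟨closure_mono ?_ hx,
      hGb ⟨map_mem_closure (continuousOn_univ.1 hF.continuousOn) hx hmaps, hHx⟩⟩
    rintro z ⟨⟨hzM, hzV⟩, hz⟩
    refine ⟨⟨mem_milnorSet_of_comp (hFd z) (hGd _) hzM fun h => hzV (hGic h), fun h => hzV ?_⟩,
      Metric.ball_subset_ball (min_le_right _ _) hz⟩
    have hz0 : F z = 0 := h
    simp [hz0, hG0]
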